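/- arXiv:2505.01268 — 2 statements merged into one kernel-verified Lean document; each statement's English description precedes it below -/
import Mathlib

section
/- Let G and H be countable discrete groups equipped with proper left-invariant metrics. Suppose G has finite asymptotic dimension and has the (m,0)-DTUT property for some m ∈ ℕ, and H is an FC-group with finite asymptotic dimension. Let W be a wreath-like product of G and H corresponding to an action H ↷ I with finitely many orbits, i.e. W fits into an extension 1 → ⊕_{i∈I} G_i → W →^ε H → 1 with each G_i ≅ G and w G_i w^{-1} = G_{ε(w).i} for all w ∈ W and i ∈ I. Suppose there exists a symmetric transversal T for ⊕_{i∈I} G_i in W whose transversal map η : H → T is unital and bornologous (with respect to d_H and a proper left-invariant metric d_W on W associated with T). Then W, equipped with d_W, has asymptotic property C. -/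
open Metric Set Function

namespace APC

variable {X Y : Type*}

/-- A family `𝒰` of subsets of a metric space is `r`-disjoint if any two distinct members
are at distance at least `r`. -/
def RDisjoint [MetricSpace X] (r : ℝ) (𝒰 : Set (Set X)) : Prop :=
  ∀ U ∈ 𝒰, ∀ V ∈ 𝒰, U ≠ V → ∀ x ∈ U, ∀ y ∈ V, r ≤ dist x y

/-- A family `𝒰` is `R`-bounded if every member has diameter at most `R`. -/
def RBounded [MetricSpace X] (R : ℝ) (𝒰 : Set (Set X)) : Prop :=
  ∀ U ∈ 𝒰, ∀ x ∈ U, ∀ y ∈ U, dist x y ≤ R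

/-- A family is uniformly bounded if it is `R`-bounded for some `R > 0`. -/
def UnifBounded [MetricSpace X] (𝒰 : Set (Set X)) : Prop :=
  ∃ R : ℝ, 0 < R ∧ RBounded R 𝒰

/-- `asdim X ≤ n`. -/
def AsdimLE (X : Type*) [MetricSpace X] (n : ℕ) : Prop :=
  ∀ r : ℝ, 0 < r → ∃ 𝒰 : Fin (n + 1) → Set (Set X),
    (∀ i, UnifBounded (𝒰 i)) ∧ (∀ i, RDisjoint r (𝒰 i)) ∧ (⋃ i, ⋃₀ 𝒰 i) = Set.univ

/-- `X` has finite asymptotic dimension. -/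
def HasFiniteAsdim (X : Type*) [MetricSpace X] : Prop := ∃ n : ℕ, AsdimLE X n

/-- Asymptotic property C. -/
def HasAPC (X : Type*) [MetricSpace X] : Prop :=
  ∀ R : ℕ → ℝ, (∀ i, 0 < R i) → StrictMono R →
    ∃ n : ℕ, ∃ 𝒰 : Fin (n + 1) → Set (Set X),
      (∀ i, UnifBounded (𝒰 i)) ∧ (∀ i : Fin (n + 1), RDisjoint (R i) (𝒰 i)) ∧
      (⋃ i, ⋃₀ 𝒰 i) = Set.univ

/-- `M^a`, the derivative of a collection of finite nonempty subsets of `ℕ`. -/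
def deriv (M : Set (Finset ℕ)) (a : ℕ) : Set (Finset ℕ) :=
  {τ | τ.Nonempty ∧ a ∉ τ ∧ insert a τ ∈ M}

/-- `OrdLE α M` means `Ord M ≤ α` in the sense of Radul: either `M = ∅`
(so that `Ord M = 0`), or `Ord M^a < α` for every `a : ℕ`.  Defined by
well-founded recursion on the ordinal `α`. -/
def OrdLE : Ordinal.{0} → Set (Finset ℕ) → Prop :=
  Ordinal.lt_wf.fix (C := fun _ => Set (Finset ℕ) → Prop)
    (fun α IH M => M = ∅ ∨ ∀ a : ℕ, ∃ β : Ordinal.{0}, ∃ hβ : β < α, IH β hβ (deriv M a))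

/-- The collection `A(X,d)` of finite nonempty subsets `σ ⊆ ℕ` such that there is no
covering of `X` by uniformly bounded families `𝒰ᵢ` (`i ∈ σ`), each `i`-disjoint. -/
def AClass (X : Type*) [MetricSpace X] : Set (Finset ℕ) :=
  {σ | σ.Nonempty ∧ ¬ ∃ 𝒰 : ℕ → Set (Set X),
      (∀ i ∈ σ, UnifBounded (𝒰 i)) ∧ (∀ i ∈ σ, RDisjoint (i : ℝ) (𝒰 i)) ∧
      (⋃ i ∈ σ, ⋃₀ 𝒰 i) = Set.univ}

/-- `trasdim X ≤ α`. -/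
def TrasdimLE (X : Type*) [MetricSpace X] (α : Ordinal.{0}) : Prop :=
  OrdLE α (AClass X)

/-- The `(m,n)`-DTUT property: disjointness of the `(m,n)`-tiling through uniform
translation. -/
def DTUT (X : Type*) [MetricSpace X] (m n : ℕ) : Prop :=
  ∃ F : Fin m → ℕ,
    ∀ h : ℕ+ → ℕ+, ∀ k : Fin (m + 1) → ℕ+, StrictMono k →
      ∃ C : (Fin m → ℕ+) → Fin (n + 1) → Set (Set X),
      ∃ D : (Fin m → ℕ+) → (i : Fin m) → Fin (F i + 1) → Set (Set X),
        ∀ l : Fin m → ℕ+, (∀ r : Fin m, l r ≤ h (k r.succ)) →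
          ((∀ j, UnifBounded (C l j)) ∧
           (∀ i s, UnifBounded (D l i s)) ∧
           (∀ j, RDisjoint ((k 0 : ℕ) : ℝ) (C l j)) ∧
           (∀ (i : Fin m) (s : Fin (F i + 1)), RDisjoint ((k i.succ : ℕ) : ℝ) (D l i s)) ∧
           ((⋃ j, ⋃₀ C l j) ∪ (⋃ i, ⋃ s, ⋃₀ D l i s) = Set.univ)) ∧
          (∀ (i : Fin m) (s : Fin (F i + 1)),
            (∀ t : ℕ+, t ≤ h (k i.succ) →
              (⋃₀ D (Function.update l i t) i s).Nonempty) ∧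
            (∀ t t' : ℕ+, t ≤ h (k i.succ) → t' ≤ h (k i.succ) → t ≠ t' →
              Disjoint (⋃₀ D (Function.update l i t) i s)
                (⋃₀ D (Function.update l i t') i s)) ∧
            RDisjoint ((k i.succ : ℕ) : ℝ)
              (⋃ t ∈ {t : ℕ+ | t ≤ h (k i.succ)}, D (Function.update l i t) i s))

/-- The word length of `g` with respect to the symmetrized generating set `S ∪ S⁻¹`. -/
noncomputable def wordLength {G : Type*} [Group G] (S : Set G) (g : G) : ℕ :=
  sInf {n : ℕ | ∃ L : List G, (∀ x ∈ L, x ∈ S ∨ x⁻¹ ∈ S) ∧ L.prod = g ∧ L.length = n}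

/-- A group is FC if every conjugacy class is finite. -/
def IsFCGroup (G : Type*) [Group G] : Prop :=
  ∀ x : G, Set.Finite {y : G | ∃ g : G, g * x * g⁻¹ = y}

/-- A metric on a countable discrete space is proper if every ball is finite. -/
def ProperMet (X : Type*) [MetricSpace X] : Prop :=
  ∀ (x : X) (R : ℝ), (Metric.closedBall x R).Finite

/-- Left invariance of a metric on a group. -/
def LeftInvariant (G : Type*) [Group G] [MetricSpace G] : Prop :=
  ∀ g x y : G, dist (g * x) (g * y) = dist x y

/-- Bornologous maps. -/
def Bornologous [MetricSpace X] [MetricSpace Y] (f : X → Y) : Prop :=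
  ∀ R : ℝ, 0 < R → ∃ P : ℝ, 0 < P ∧ ∀ x y : X, dist x y < R → dist (f x) (f y) < P

/-- Coarse embeddings. -/
def CoarseEmbedding [MetricSpace X] [MetricSpace Y] (f : X → Y) : Prop :=
  ∃ ρminus ρplus : ℝ → ℝ, Monotone ρminus ∧ Monotone ρplus ∧
    Filter.Tendsto ρminus Filter.atTop Filter.atTop ∧
    (∀ x y : X, ρminus (dist x y) ≤ dist (f x) (f y) ∧ dist (f x) (f y) ≤ ρplus (dist x y))

/-- Coarse equivalences: coarse embeddings with coarsely dense image. -/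
def CoarseEquiv [MetricSpace X] [MetricSpace Y] (f : X → Y) : Prop :=
  CoarseEmbedding f ∧ ∃ C : ℝ, 0 < C ∧ ∀ y : Y, ∃ x : X, dist y (f x) ≤ C

end APC

namespace APC

/-- The subgroup of finitely supported functions `I → G`, i.e. the restricted direct
product `⊕_{i ∈ I} G`. -/
def finSuppSubgroup (I G : Type*) [Group G] : Subgroup (I → G) where
  carrier := {f | (Function.mulSupport f).Finite}
  one_mem' := by
    simp [Function.mulSupport_one]
  mul_mem' := by
    intro a b ha hb
    refine (ha.union hb).subset fun x hx => ?_
    by_contra hc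
    simp only [Set.mem_union, Function.mem_mulSupport, not_or, not_not] at hc
    exact (Function.mem_mulSupport.mp hx) (by rw [Pi.mul_apply, hc.1, hc.2, one_mul])
  inv_mem' := by
    intro a ha
    refine ha.subset fun x hx => ?_
    have := Function.mem_mulSupport.mp hx
    rw [Pi.inv_apply, ne_eq, inv_eq_one] at this
    exact Function.mem_mulSupport.mpr this

end APC

open APC Set

namespace APC

/-- A cover witnessing `asdim X ≤ n` at scale `r`, encoded by a colour `χ x` and a
representative point `β x` of the member of the cover assigned to `x`. -/
lemma AsdimLE.exists_coloring {X : Type*} [MetricSpace X] {n : ℕ} (h : AsdimLE X n)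
    {r : ℝ} (hr : 0 < r) :
    ∃ (R : ℝ) (χ : X → Fin (n + 1)) (β : X → X), (∀ x, dist x (β x) ≤ R) ∧
      ∀ x y, χ x = χ y → dist x y < r → β x = β y := by
  obtain ⟨𝒰, hb, hd, hc⟩ := h r hr
  have hmem : ∀ x : X, ∃ i, ∃ U ∈ 𝒰 i, x ∈ U := fun x => by
    have hx : x ∈ ⋃ i, ⋃₀ 𝒰 i := hc ▸ Set.mem_univ x
    simpa only [Set.mem_iUnion, Set.mem_sUnion] using hx
  choose χ U hU hxU using hmem
  choose R _ hR using hb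
  obtain ⟨M, hM⟩ := Finite.exists_le R
  refine ⟨M, χ, fun x => @Classical.epsilon X ⟨x⟩ (· ∈ U x), fun x => ?_, fun x y hχ hxy => ?_⟩
  · have hε : @Classical.epsilon X ⟨x⟩ (· ∈ U x) ∈ U x :=
      Classical.epsilon_spec (p := (· ∈ U x)) ⟨x, hxU x⟩
    exact (hR (χ x) (U x) (hU x) x (hxU x) _ hε).trans (hM _)
  · have hUU : U x = U y := by
      by_contra hne
      exact absurd (hd (χ x) (U x) (hU x) (U y) (hχ ▸ hU y) hne x (hxU x) y (hxU y)) (not_le.2 hxy)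
    simp only [hUU]

/-- The laws of a (possibly infinite-valued) pseudometric, phrased in terms of the relations
`near κ x y`, to be read as: `x` and `y` are at distance at most `κ`. -/
structure IsNearness {Q : Type*} (near : ℝ → Q → Q → Prop) : Prop where
  refl : ∀ x, near 0 x x
  symm : ∀ {a x y}, near a x y → near a y x
  mono : ∀ {a b x y}, a ≤ b → near a x y → near b x y
  trans : ∀ {a b x y z}, near a x y → near b y z → near (a + b) x z

/-- The set `X` splits into pieces of diameter at most `R` such that `κ`-near points
lie in the same piece. -/
def ZeroDim {Q : Type*} (near : ℝ → Q → Q → Prop) (κ R : ℝ) (X : Set Q) : Prop :=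
  ∃ E : Setoid Q, (∀ x ∈ X, ∀ y ∈ X, near κ x y → E x y) ∧
    ∀ x ∈ X, ∀ y ∈ X, E x y → near R x y

/-- The union theorem: a zero-dimensional decomposition at scale `κ` can be merged with one whose
scale is much larger than the diameters of the pieces of the first. -/
lemma ZeroDim.union {Q : Type*} {near : ℝ → Q → Q → Prop} (hn : IsNearness near)
    {κ R R' : ℝ} (hκ : 0 ≤ κ) (hR : 0 ≤ R) (hR' : 0 ≤ R') {X Y : Set Q}
    (hX : ZeroDim near κ R X) (hY : ZeroDim near (2 * R + 3 * κ) R' Y) :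
    ZeroDim near κ (R' + 2 * R + 2 * κ) (X ∪ Y) := by
  classical
  obtain ⟨E, hE, hE'⟩ := hX
  obtain ⟨E', hF, hF'⟩ := hY
  let att : Q → Prop := fun x =>
    x ∈ Y ∨ (x ∈ X ∧ ∃ x' ∈ X, E x x' ∧ ∃ y ∈ Y, near κ x' y)
  have hatt : ∀ x, ∃ y, att x → y ∈ Y ∧ near (R + κ) x y := by
    intro x
    by_cases hx : att x
    · rcases hx with hx | ⟨hx, x', hx', hxx', y, hy, hxy⟩
      · exact ⟨x, fun _ => ⟨hx, hn.mono (by positivity) (hn.refl x)⟩⟩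
      · exact ⟨y, fun _ => ⟨hy, hn.trans (hE' x hx x' hx' hxx') hxy⟩⟩
    · exact ⟨x, fun h => absurd h hx⟩
  choose p hp using hatt
  have hprop : ∀ x ∈ X ∪ Y, ∀ y ∈ X ∪ Y, near κ x y → att x → att y := by
    rintro x - y hy hxy hx
    rcases hy with hy | hy
    · rcases hx with hx | ⟨hx, x', hx', hxx', z, hz, hxz⟩
      · exact Or.inr ⟨hy, y, hy, E.refl y, x, hx, hn.symm hxy⟩
      · exact Or.inr ⟨hy, x', hx', E.trans (E.symm (hE x hx y hy hxy)) hxx', z, hz, hxz⟩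
    · exact Or.inl hy
  have hmemX : ∀ x ∈ X ∪ Y, ¬ att x → x ∈ X := fun x hx hxa =>
    hx.resolve_right fun h => hxa (Or.inl h)
  let lab : Q → Quotient E ⊕ Quotient E' := fun x =>
    if att x then Sum.inr (Quotient.mk E' (p x)) else Sum.inl (Quotient.mk E x)
  refine ⟨Setoid.ker lab, fun x hx y hy hxy => ?_, fun x hx y hy hxy => ?_⟩
  · rw [Setoid.ker_def]
    by_cases hxa : att x
    · have hya := hprop x hx y hy hxy hxa
      simp only [lab, if_pos hxa, if_pos hya]
      refine congrArg _ (Quotient.sound (hF _ (hp x hxa).1 _ (hp y hya).1 ?_))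
      exact hn.mono (by linarith)
        (hn.trans (hn.symm (hp x hxa).2) (hn.trans hxy (hp y hya).2))
    · have hya : ¬ att y := fun h => hxa (hprop y hy x hx (hn.symm hxy) h)
      simp only [lab, if_neg hxa, if_neg hya]
      exact congrArg _ (Quotient.sound (hE _ (hmemX x hx hxa) _ (hmemX y hy hya) hxy))
  · rw [Setoid.ker_def] at hxy
    by_cases hxa : att x <;> by_cases hya : att y
    · simp only [lab, if_pos hxa, if_pos hya, Sum.inr.injEq] at hxy
      have := hF' _ (hp x hxa).1 _ (hp y hya).1 (Quotient.exact hxy)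
      exact hn.mono (by linarith)
        (hn.trans (hp x hxa).2 (hn.trans this (hn.symm (hp y hya).2)))
    · simp [lab, hxa, hya] at hxy
    · simp [lab, hxa, hya] at hxy
    · simp only [lab, if_neg hxa, if_neg hya, Sum.inl.injEq] at hxy
      exact hn.mono (by linarith)
        (hE' _ (hmemX x hx hxa) _ (hmemX y hy hya) (Quotient.exact hxy))

/-- Nearness on `I → G`: equality outside of `J`, and distance at most `κ` in every coordinate. -/
def piNear {I G : Type*} [MetricSpace G] (J : Finset I) (κ : ℝ) (y y' : I → G) : Prop :=
  (∀ j ∉ J, y j = y' j) ∧ ∀ j, dist (y j) (y' j) ≤ κ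

/-- The tiling lemma. Along a chain `J 0 ⊆ ⋯ ⊆ J m` of sets of coordinates, `I → G` can be
coloured by few colours at each level `i`, the colours of level `i` being zero-dimensional with
respect to the coordinates in `J i`, while their number depends only on the sizes of
the previous members of the chain. -/
lemma exists_coloring_pi {G : Type*} [MetricSpace G] {m a : ℕ} (hG : AsdimLE G a)
    (hD : DTUT G m 0) :
    ∃ f : ℕ → ℕ, ∀ {I : Type*} (N : ℕ) (κ : ℝ), ∃ R : ℝ, 0 ≤ R ∧
      ∀ (ν : Fin (m + 1) → ℕ) (J : Fin (m + 1) → Finset I), Monotone J →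
        (J (Fin.last m)).card ≤ N → (∀ i : Fin m, (J i.castSucc).card ≤ ν i.succ) →
        ∃ col : (I → G) → Fin (m + 1) × ℕ, (∀ y, (col y).2 < f (ν (col y).1)) ∧
          ∀ c, ZeroDim (piNear (J c.1)) κ R {y | col y = c} := by
  classical
  obtain ⟨F, hF⟩ := hD
  obtain ⟨F', hF'⟩ := Finite.exists_le F
  refine ⟨fun ν => ν * ((F' + 1) * (a + 1) ^ ν) + 1, fun {I} N κ => ?_⟩
  obtain ⟨ρ, χ, β, hβ, hχ⟩ := hG.exists_coloring (show 0 < |κ| + 1 by positivity)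
  let B : ℕ+ := ⟨(a + 1) ^ N, by positivity⟩
  let k : Fin (m + 1) → ℕ+ := fun i => ⟨⌈|κ|⌉₊ + i + 1, by positivity⟩
  have hk : StrictMono k := fun i j hij => by
    have : (i : ℕ) < j := hij
    rw [← PNat.coe_lt_coe]
    simp only [k, PNat.mk_coe]
    omega
  have hκk : ∀ i, κ < ((k i : ℕ) : ℝ) := fun i => by
    have h1 := (le_abs_self κ).trans (Nat.le_ceil |κ|)
    have h2 : ((⌈|κ|⌉₊ : ℕ) : ℝ) < ((k i : ℕ) : ℝ) := by
      simp only [k, PNat.mk_coe]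
      exact_mod_cast (by omega)
    linarith
  have hκ1 : κ < |κ| + 1 := by linarith [le_abs_self κ]
  obtain ⟨C, D, hCD⟩ := hF (fun _ => B) k hk
  have hfin : {l : Fin m → ℕ+ | ∀ r, l r ≤ B}.Finite :=
    Set.Finite.pi' fun _ => Set.finite_Iic B
  obtain ⟨RC, hRC⟩ : ∃ RC : ℝ, ∀ l : Fin m → ℕ+, (∀ r, l r ≤ B) → RBounded RC (C l 0) := by
    have h1 : ∀ l : Fin m → ℕ+, ∃ r : ℝ, (∀ r, l r ≤ B) → RBounded r (C l 0) := fun l => by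
      by_cases hl : ∀ r, l r ≤ B
      · obtain ⟨r, -, hr⟩ := (hCD l hl).1.1 0
        exact ⟨r, fun _ => hr⟩
      · exact ⟨0, fun h => absurd h hl⟩
    choose r hr using h1
    obtain ⟨M, hM⟩ := (hfin.image r).bddAbove
    exact ⟨M, fun l hl U hU x hx y hy =>
      (hr l hl U hU x hx y hy).trans (hM ⟨l, hl, rfl⟩)⟩
  refine ⟨max 0 (max (2 * ρ) RC), le_max_left _ _, fun ν J hJ hN hν => ?_⟩
  -- the tiling index of a point
  obtain ⟨e, heinj, heB⟩ : ∃ e : (J (Fin.last m) → Fin (a + 1)) → ℕ+,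
      Function.Injective e ∧ ∀ x, e x ≤ B := by
    let e₀ := Fintype.equivFin (J (Fin.last m) → Fin (a + 1))
    refine ⟨fun x => (e₀ x : ℕ).succPNat, fun x x' h => ?_, fun x => ?_⟩
    · exact e₀.injective (Fin.ext (Nat.succPNat_injective h))
    · rw [← PNat.coe_le_coe, Nat.succPNat_coe, Nat.succ_le_iff]
      refine (e₀ x).2.trans_le ?_
      rw [Fintype.card_fun, Fintype.card_fin, Fintype.card_coe]
      exact Nat.pow_le_pow_right (by omega) hN
  let l : (I → G) → Fin m → ℕ+ := fun y r =>
    e fun j => if (j : I) ∈ J r.succ ∧ (j : I) ∉ J r.castSucc then χ (y j) else 0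
  have hlB : ∀ y r, l y r ≤ B := fun y r => heB _
  have hl_of : ∀ y y' r, (∀ j ∈ J r.succ, j ∉ J r.castSucc → χ (y j) = χ (y' j)) →
      l y r = l y' r := by
    intro y y' r h
    refine congrArg e (funext fun j => ?_)
    split_ifs with hj
    · exact h _ hj.1 hj.2
    · rfl
  have hl_imp : ∀ y y' r, l y r = l y' r →
      ∀ j ∈ J r.succ, j ∉ J r.castSucc → χ (y j) = χ (y' j) := by
    intro y y' r h j hj hj'
    have := congrFun (heinj h) ⟨j, hJ (Fin.le_last _) hj⟩
    simpa only [hj, hj', not_false_eq_true, and_self, if_true] using this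
  -- the colouring
  let T : Fin m → Type _ := fun i =>
    J i.castSucc × Fin (F' + 1) × (J i.castSucc → Fin (a + 1))
  let good : (I → G) → Fin (m + 1) × ℕ → Prop := fun y c =>
    (c = (0, 0) ∧ ∀ j ∈ J 0, y j ∈ ⋃₀ C (l y) 0) ∨
    ∃ i : Fin m, c.1 = i.succ ∧ ∃ (j : J i.castSucc) (s : Fin (F i + 1)),
      y j ∈ ⋃₀ D (l y) i s ∧
      c.2 = Fintype.equivFin (T i)
        (j, Fin.castLE (Nat.succ_le_succ (hF' i)) s, fun j' => χ (y j'))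
  have hgood : ∀ y, ∃ c, good y c := by
    intro y
    by_cases h0 : ∀ j ∈ J 0, y j ∈ ⋃₀ C (l y) 0
    · exact ⟨(0, 0), Or.inl ⟨rfl, h0⟩⟩
    · push Not at h0
      obtain ⟨j, hj, hjC⟩ := h0
      have hcov := (hCD (l y) (hlB y)).1.2.2.2.2
      have hmem : y j ∈ (⋃ j, ⋃₀ C (l y) j) ∪ ⋃ i, ⋃ s, ⋃₀ D (l y) i s :=
        hcov ▸ Set.mem_univ _
      rcases hmem with hmem | hmem
      · obtain ⟨q, hq⟩ := Set.mem_iUnion.1 hmem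
        rw [show q = 0 from Fin.fin_one_eq_zero q] at hq
        exact absurd hq hjC
      · obtain ⟨i, hi⟩ := Set.mem_iUnion.1 hmem
        obtain ⟨s, hs⟩ := Set.mem_iUnion.1 hi
        exact ⟨(i.succ, _), Or.inr ⟨i, rfl, ⟨j, hJ (Fin.zero_le _) hj⟩, s, hs, rfl⟩⟩
  choose col hcol using hgood
  refine ⟨col, fun y => ?_, fun c => ?_⟩
  · rcases hcol y with ⟨h, -⟩ | ⟨i, hi, j, s, -, h⟩
    · rw [h]
      exact Nat.succ_pos _
    · rw [hi, h]
      refine (Fin.is_lt _).trans_le ?_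
      simp only [T, Fintype.card_prod, Fintype.card_fun, Fintype.card_fin, Fintype.card_coe]
      exact (Nat.mul_le_mul (hν i) (Nat.mul_le_mul le_rfl
        (Nat.pow_le_pow_right (by omega) (hν i)))).trans (Nat.le_succ _)
  · by_cases hc : c.1 = 0
    · -- the level of the tiles `C`
      have hC : ∀ y, col y = c → ∀ j ∈ J 0, y j ∈ ⋃₀ C (l y) 0 := by
        intro y hy
        rcases hcol y with ⟨-, h⟩ | ⟨i, hi, -⟩
        · exact h
        · rw [hy, hc] at hi
          exact absurd hi.symm (Fin.succ_ne_zero i)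
      have hll : ∀ y y' : I → G, (∀ j ∉ J 0, y j = y' j) → l y = l y' := fun y y' h =>
        funext fun r => hl_of _ _ _ fun j _ hj' => by
          rw [h j fun hj0 => hj' (hJ (Fin.zero_le _) hj0)]
      have hU : ∀ y j, ∃ U : Set G, col y = c → j ∈ J 0 → U ∈ C (l y) 0 ∧ y j ∈ U := by
        intro y j
        by_cases h : col y = c ∧ j ∈ J 0
        · obtain ⟨U, hU, hyU⟩ := hC y h.1 j h.2
          exact ⟨U, fun _ _ => ⟨hU, hyU⟩⟩
        · exact ⟨∅, fun h1 h2 => absurd ⟨h1, h2⟩ h⟩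
      choose U hU using hU
      let lab : (I → G) → I → Set G := fun y j => if j ∈ J 0 then U y j else {y j}
      rw [hc]
      refine ⟨Setoid.ker lab, fun y hy y' hy' hyy' => ?_, fun y hy y' hy' hyy' => ?_⟩
      · rw [Setoid.ker_def]
        funext j
        by_cases hj : j ∈ J 0
        · simp only [lab, if_pos hj]
          by_contra hne
          have := (hCD (l y) (hlB y)).1.2.2.1 0 _ (hU y j hy hj).1 _
            (hll y y' hyy'.1 ▸ (hU y' j hy' hj).1) hne _ (hU y j hy hj).2 _ (hU y' j hy' hj).2
          linarith [hyy'.2 j, hκk 0]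
        · simp only [lab, if_neg hj, hyy'.1 j hj]
      · rw [Setoid.ker_def] at hyy'
        have h1 : ∀ j ∉ J 0, y j = y' j := fun j hj => by
          have := congrFun hyy' j
          simpa only [lab, if_neg hj, Set.singleton_eq_singleton_iff] using this
        refine ⟨h1, fun j => ?_⟩
        by_cases hj : j ∈ J 0
        · have := congrFun hyy' j
          simp only [lab, if_pos hj] at this
          refine (hRC (l y) (hlB y) _ (hU y j hy hj).1 _ (hU y j hy hj).2 _
            (this ▸ (hU y' j hy' hj).2)).trans ((le_max_right _ _).trans (le_max_right _ _))
        · rw [h1 j hj, dist_self]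
          exact le_max_left _ _
    · -- the levels of the walls `D`
      obtain ⟨i, hi⟩ := Fin.exists_succ_eq.2 hc
      let lab : (I → G) → I → G := fun y j => if j ∈ J i.succ then β (y j) else y j
      rw [← hi]
      refine ⟨Setoid.ker lab, fun y hy y' hy' hyy' => ?_, fun y _ y' _ hyy' => ?_⟩
      · have key : ∀ y, col y = c → ∃ (j : J i.castSucc) (s : Fin (F i + 1)),
            y j ∈ ⋃₀ D (l y) i s ∧ c.2 = Fintype.equivFin (T i)
              (j, Fin.castLE (Nat.succ_le_succ (hF' i)) s, fun j' => χ (y j')) := by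
          intro y hy
          rcases hcol y with ⟨h, -⟩ | ⟨i', hi', h⟩
          · rw [hy] at h
            exact absurd (congrArg Prod.fst h) hc
          · rw [hy, ← hi] at hi'
            obtain rfl := Fin.succ_injective _ hi'
            rwa [hy] at h
        obtain ⟨j, s, ⟨V, hV, hyV⟩, hcj⟩ := key y hy
        obtain ⟨j', s', ⟨V', hV', hyV'⟩, hcj'⟩ := key y' hy'
        have heq : ((j, Fin.castLE (Nat.succ_le_succ (hF' i)) s, fun j' => χ (y j')) : T i) =
            ((j', Fin.castLE (Nat.succ_le_succ (hF' i)) s', fun j' => χ (y' j')) : T i) :=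
          (Fintype.equivFin (T i)).injective (Fin.ext (hcj.symm.trans hcj'))
        obtain rfl : j = j' := congrArg (fun x : T i => x.1) heq
        obtain rfl : s = s' := Fin.castLE_injective (Nat.succ_le_succ (hF' i))
          (congrArg (fun x : T i => x.2.1) heq)
        have hdata : (fun j' : J i.castSucc => χ (y j')) =
              fun j' : J i.castSucc => χ (y' j') :=
          congrArg (fun x : T i => x.2.2) heq
        have hχ1 : ∀ j ∈ J i.castSucc, χ (y j) = χ (y' j) := fun j hj => congrFun hdata ⟨j, hj⟩
        have hlr : ∀ r, r ≠ i → l y r = l y' r := by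
          intro r hr
          refine hl_of _ _ _ fun j hj hj' => ?_
          rcases lt_or_gt_of_ne hr with hlt | hgt
          · exact hχ1 j (hJ (by rw [Fin.succ_le_castSucc_iff]; exact hlt) hj)
          · rw [hyy'.1 j fun h => hj' (hJ (by rw [Fin.succ_le_castSucc_iff]; exact hgt) h)]
        have hup : Function.update (l y) i (l y' i) = l y' := by
          funext r
          by_cases hr : r = i
          · subst hr; simp
          · rw [Function.update_of_ne hr, hlr r hr]
        have htrans := (hCD (l y) (hlB y)).2 i s
        have hVV' : V = V' := by
          by_contra hne
          have := htrans.2.2 V (Set.mem_biUnion (hlB y i)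
              (by rw [Function.update_eq_self]; exact hV))
            V' (Set.mem_biUnion (hlB y' i) (by rw [hup]; exact hV')) hne _ hyV _ hyV'
          linarith [hyy'.2 j, hκk i.succ]
        have hli : l y i = l y' i := by
          by_contra hne
          have := htrans.2.1 _ _ (hlB y i) (hlB y' i) hne
          rw [Function.update_eq_self, hup] at this
          exact Set.disjoint_left.1 this ⟨V, hV, hyV⟩ ⟨V', hV', hVV' ▸ hyV⟩
        rw [Setoid.ker_def]
        funext j₁
        by_cases hj₁ : j₁ ∈ J i.succ
        · simp only [lab, if_pos hj₁]
          refine hχ _ _ ?_ ((hyy'.2 j₁).trans_lt hκ1)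
          by_cases hj₂ : j₁ ∈ J i.castSucc
          · exact hχ1 j₁ hj₂
          · exact hl_imp y y' i hli j₁ hj₁ hj₂
        · simp only [lab, if_neg hj₁, hyy'.1 j₁ hj₁]
      · rw [Setoid.ker_def] at hyy'
        have h1 : ∀ j ∉ J i.succ, y j = y' j := fun j hj => by
          have := congrFun hyy' j
          simpa only [lab, if_neg hj] using this
        refine ⟨h1, fun j => ?_⟩
        by_cases hj : j ∈ J i.succ
        · have := congrFun hyy' j
          simp only [lab, if_pos hj] at this
          have h2 := dist_triangle_right (y j) (y' j) (β (y j))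
          have h3 := hβ (y j)
          have h4 := hβ (y' j)
          rw [← this] at h4
          exact (by linarith : dist (y j) (y' j) ≤ 2 * ρ).trans
            ((le_max_left _ _).trans (le_max_right _ _))
        · rw [h1 j hj, dist_self]
          exact le_max_left _ _

/-- Nearness on `(I → G) × Σ`, where the set of free coordinates depends on the point of `Σ`. -/
def sigmaNear {I G S : Type*} [MetricSpace G] (J : S → Finset I) (κ : ℝ)
    (p q : (I → G) × S) : Prop :=
  J p.2 = J q.2 ∧ piNear (J p.2) κ p.1 q.1

lemma isNearness_sigmaNear {I G S : Type*} [MetricSpace G] (J : S → Finset I) :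
    IsNearness (sigmaNear (G := G) J) where
  refl p := ⟨rfl, fun _ _ => rfl, fun j => (dist_self _).le⟩
  symm h := ⟨h.1.symm, fun j hj => (h.2.1 j (h.1 ▸ hj)).symm, fun j => by
    rw [dist_comm]; exact h.2.2 j⟩
  mono hab h := ⟨h.1, h.2.1, fun j => (h.2.2 j).trans hab⟩
  trans h h' := ⟨h.1.trans h'.1, fun j hj => (h.2.1 j hj).trans (h'.2.1 j (h.1 ▸ hj)),
    fun j => (dist_triangle _ _ _).trans (add_le_add (h.2.2 j) (h'.2.2 j))⟩

/-- The tiling lemma for finitely many chains of sets of coordinates simultaneously. -/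
lemma exists_coloring_sigma {G : Type*} [MetricSpace G] {m a : ℕ} (hG : AsdimLE G a)
    (hD : DTUT G m 0) :
    ∃ f : ℕ → ℕ, ∀ {I S : Type*} (N : ℕ) (P : Finset S) (κ : ℝ), 0 ≤ κ → ∃ R : ℝ, 0 ≤ R ∧
      ∀ (ν : Fin (m + 1) → ℕ) (J : S → Fin (m + 1) → Finset I), (∀ s, Monotone (J s)) →
        (∀ s, (J s (Fin.last m)).card ≤ N) →
        (∀ s, ∀ i : Fin m, (J s i.castSucc).card ≤ ν i.succ) →
        ∃ col : (I → G) × S → Fin (m + 1) × ℕ,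
          (∀ p, p.2 ∈ P → (col p).2 < f (ν (col p).1)) ∧
          ∀ c, ZeroDim (sigmaNear fun s => J s c.1) κ R {p | p.2 ∈ P ∧ col p = c} := by
  classical
  obtain ⟨f, hf⟩ := exists_coloring_pi hG hD
  refine ⟨f, fun {I S} N P => ?_⟩
  induction P using Finset.induction_on with
  | empty =>
    intro κ _
    exact ⟨0, le_rfl, fun ν J _ _ _ => ⟨fun _ => (0, 0),
      fun p hp => absurd hp (Finset.notMem_empty _),
      fun c => ⟨⊤, fun p hp => absurd hp.1 (Finset.notMem_empty _),
        fun p hp => absurd hp.1 (Finset.notMem_empty _)⟩⟩⟩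
  | insert s P hs ih =>
    intro κ hκ
    obtain ⟨R, hR, h⟩ := ih κ hκ
    obtain ⟨R', hR', h'⟩ := hf (I := I) N (2 * R + 3 * κ)
    refine ⟨R' + 2 * R + 2 * κ, by positivity, fun ν J hJ hN hν => ?_⟩
    obtain ⟨col, hcol, hzero⟩ := h ν J hJ hN hν
    obtain ⟨col', hcol', hzero'⟩ := h' ν (J s) (hJ s) (hN s) (hν s)
    refine ⟨fun p => if p.2 = s then col' p.1 else col p, fun p hp => ?_, fun c => ?_⟩
    · dsimp only
      split_ifs with hps
      · exact hcol' p.1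
      · exact hcol p ((Finset.mem_insert.1 hp).resolve_left hps)
    · have hs' : ZeroDim (sigmaNear fun s => J s c.1) (2 * R + 3 * κ) R'
          {p : (I → G) × S | p.2 = s ∧ col' p.1 = c} := by
        obtain ⟨E, hE, hE'⟩ := hzero' c
        refine ⟨E.comap Prod.fst, ?_, ?_⟩
        · rintro ⟨y, t⟩ ⟨rfl, hy⟩ ⟨y', t'⟩ ⟨rfl, hy'⟩ hyy'
          exact hE y hy y' hy' hyy'.2
        · rintro ⟨y, t⟩ ⟨rfl, hy⟩ ⟨y', t'⟩ ⟨rfl, hy'⟩ hyy'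
          exact ⟨rfl, hE' y hy y' hy' hyy'⟩
      convert (hzero c).union (isNearness_sigmaNear _) hκ hR hR' hs' using 1
      ext p
      simp only [Set.mem_ofPred_eq, Set.mem_union, Finset.mem_insert]
      by_cases hps : p.2 = s
      · simp [hps, hs]
      · simp [hps]

section Extension

variable {G H W I : Type*} [Group G] [Group H] [Group W] {ε : W →* H}
  (φ : ε.ker ≃* finSuppSubgroup I G)

/-- If conjugation permutes the factors of `⊕_{i ∈ I} G` according to the action of `H` on `I`,
then it translates supports. -/
lemma mulSupport_conjNormal_subset [MulAction H I]
    (hconj : ∀ (w : W) (i : I),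
      (fun x => w * x * w⁻¹) ''
          {x : W | ∃ hx : x ∈ ε.ker, Function.mulSupport ((φ ⟨x, hx⟩ : I → G)) ⊆ {i}} =
        {x : W | ∃ hx : x ∈ ε.ker, Function.mulSupport ((φ ⟨x, hx⟩ : I → G)) ⊆ {ε w • i}})
    (w : W) (n : ε.ker) :
    mulSupport (φ (MulAut.conjNormal w n) : I → G) ⊆ (ε w • ·) '' mulSupport (φ n : I → G) := by
  classical
  have key : ∀ (P : Finset I) (n : ε.ker), mulSupport (φ n : I → G) ⊆ P →
      mulSupport (φ (MulAut.conjNormal w n) : I → G) ⊆ (ε w • ·) '' (P : Set I) := by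
    intro P
    induction P using Finset.induction_on with
    | empty =>
      intro n hn
      have h1 : φ n = 1 := by
        ext1
        exact mulSupport_eq_empty_iff.1 (Set.subset_empty_iff.1 (by simpa using hn))
      have h2 : n = 1 := by simpa using h1
      simp [h2]
    | insert i P hi ih =>
      intro n hn
      have hfin : (mulSupport (Pi.mulSingle i ((φ n : I → G) i))).Finite :=
        (Set.finite_singleton i).subset Pi.mulSupport_mulSingle_subset
      let x : finSuppSubgroup I G := ⟨Pi.mulSingle i ((φ n : I → G) i), hfin⟩
      have hx : (φ (φ.symm x) : I → G) = Pi.mulSingle i ((φ n : I → G) i) := by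
        rw [MulEquiv.apply_symm_apply]
      have hrest : mulSupport (φ ((φ.symm x)⁻¹ * n) : I → G) ⊆ P := by
        intro j hj
        have hval : (φ ((φ.symm x)⁻¹ * n) : I → G) j
            = ((Pi.mulSingle i ((φ n : I → G) i) : I → G) j)⁻¹ * (φ n : I → G) j := by
          rw [map_mul, map_inv, ← hx]
          rfl
        rw [mem_mulSupport, hval] at hj
        by_cases hji : j = i
        · subst hji
          simp at hj
        · rw [Pi.mulSingle_eq_of_ne hji, inv_one, one_mul] at hj
          exact (Finset.mem_insert.1 (hn hj)).resolve_left hji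
      have hsingle : mulSupport (φ (MulAut.conjNormal w (φ.symm x)) : I → G) ⊆ {ε w • i} := by
        have hmem : w * (φ.symm x : W) * w⁻¹ ∈ {x : W | ∃ hx : x ∈ ε.ker,
            Function.mulSupport ((φ ⟨x, hx⟩ : I → G)) ⊆ {ε w • i}} := by
          rw [← hconj w i]
          refine ⟨_, ⟨(φ.symm x).2, ?_⟩, rfl⟩
          rw [Subtype.coe_eta, hx]
          exact Pi.mulSupport_mulSingle_subset
        obtain ⟨_, h⟩ := hmem
        exact h
      have hn' : n = φ.symm x * ((φ.symm x)⁻¹ * n) := by group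
      rw [hn', map_mul, map_mul, Subgroup.coe_mul]
      refine (mulSupport_mul _ _).trans
        (Set.union_subset (hsingle.trans ?_) ((ih _ hrest).trans ?_))
      · exact Set.singleton_subset_iff.2 ⟨i, Finset.mem_coe.2 (Finset.mem_insert_self _ _), rfl⟩
      · exact Set.image_mono (Finset.coe_subset.2 (Finset.subset_insert _ _))
  have hfin : (mulSupport (φ n : I → G)).Finite := (φ n).2
  simpa using key hfin.toFinset n (by simp)

lemma exists_finset_mulSupport_subset {K : Set W} (hK : K.Finite) :
    ∃ S : Finset I, ∀ n : ε.ker, (n : W) ∈ K → mulSupport (φ n : I → G) ⊆ S := by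
  have hK' : {n : ε.ker | (n : W) ∈ K}.Finite := hK.preimage Subtype.coe_injective.injOn
  have hfin : (⋃ n ∈ {n : ε.ker | (n : W) ∈ K}, mulSupport (φ n : I → G)).Finite :=
    hK'.biUnion fun n _ => (φ n).2
  refine ⟨hfin.toFinset, fun n hn => ?_⟩
  rw [Set.Finite.coe_toFinset]
  exact Set.subset_biUnion_of_mem (u := fun n : ε.ker => mulSupport (φ n : I → G))
    (show n ∈ {n : ε.ker | (n : W) ∈ K} from hn)

lemma exists_dist_one_le [MetricSpace G] {K : Set W} (hK : K.Finite) :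
    ∃ κ : ℝ, 0 ≤ κ ∧ ∀ n : ε.ker, (n : W) ∈ K → ∀ j, dist 1 ((φ n : I → G) j) ≤ κ := by
  have hK' : {n : ε.ker | (n : W) ∈ K}.Finite := hK.preimage Subtype.coe_injective.injOn
  have hfin : (⋃ n ∈ {n : ε.ker | (n : W) ∈ K}, insert 1
      ((φ n : I → G) '' mulSupport (φ n : I → G))).Finite :=
    hK'.biUnion fun n _ => (Set.Finite.image _ (φ n).2).insert _
  obtain ⟨M, hM⟩ := (hfin.image (dist (1 : G))).bddAbove
  refine ⟨max 0 M, le_max_left _ _, fun n hn j => le_trans (hM ⟨_, ?_, rfl⟩) (le_max_right _ _)⟩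
  refine Set.mem_biUnion (show n ∈ {n : ε.ker | (n : W) ∈ K} from hn) ?_
  by_cases hj : (φ n : I → G) j = 1
  · exact Or.inl hj
  · exact Or.inr ⟨j, hj, rfl⟩

lemma finite_setOf_mulSupport_subset [MetricSpace G] (hG : ProperMet G) (S : Finset I) (R : ℝ) :
    {n : ε.ker | mulSupport (φ n : I → G) ⊆ S ∧ ∀ j, dist 1 ((φ n : I → G) j) ≤ R}.Finite := by
  refine Set.Finite.of_injOn (f := fun n (j : S) => (φ n : I → G) j)
    (t := {y : S → G | ∀ j, y j ∈ closedBall 1 R}) (fun n hn j => ?_) (fun n hn n' hn' h => ?_)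
    (Set.Finite.pi' fun _ => hG 1 R)
  · rw [mem_closedBall, dist_comm]
    exact hn.2 j
  · refine φ.injective (Subtype.ext (funext fun j => ?_))
    by_cases hj : j ∈ S
    · exact congrFun h ⟨j, hj⟩
    · rw [notMem_mulSupport.1 fun h => hj (hn.1 h), notMem_mulSupport.1 fun h => hj (hn'.1 h)]

end Extension

lemma LeftInvariant.dist_one {G : Type*} [Group G] [MetricSpace G] (h : LeftInvariant G)
    (x y : G) : dist 1 (x⁻¹ * y) = dist x y := by
  rw [← h x, mul_one, mul_inv_cancel_left]

/-- A homomorphism from a group with a proper left-invariant metric is bornologous. -/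
lemma bornologous_of_hom {W H : Type*} [Group W] [Group H] [MetricSpace W] [MetricSpace H]
    (hW : ProperMet W) (hWinv : LeftInvariant W) (hHinv : LeftInvariant H) (ε : W →* H) :
    Bornologous ε := by
  intro k _
  obtain ⟨M, hM⟩ := ((hW 1 k).image fun w => dist 1 (ε w)).bddAbove
  refine ⟨max 0 M + 1, by positivity, fun w w' hww' => ?_⟩
  have h := hM ⟨w⁻¹ * w', by rw [mem_closedBall, dist_comm, hWinv.dist_one]; exact hww'.le, rfl⟩
  simp only [map_mul, map_inv, hHinv.dist_one] at h
  linarith [le_max_right 0 M]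

section Levels

variable {G H W I : Type*} [Group G] [Group H] [Group W] [MulAction H I]
  [MetricSpace H] [MetricSpace W] {ε : W →* H} (φ : ε.ker ≃* finSuppSubgroup I G)

/-- Moves of bounded size in `W` only affect coordinates in a translate of a finite set. -/
lemma exists_finset_mulSupport_subset_smul
    (hWproper : ProperMet W) (hWinv : LeftInvariant W)
    (hconj : ∀ (w : W) (i : I),
      (fun x => w * x * w⁻¹) ''
          {x : W | ∃ hx : x ∈ ε.ker, Function.mulSupport ((φ ⟨x, hx⟩ : I → G)) ⊆ {i}} =
        {x : W | ∃ hx : x ∈ ε.ker, Function.mulSupport ((φ ⟨x, hx⟩ : I → G)) ⊆ {ε w • i}})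
    {η : H → W} (hηsec : ∀ h : H, ε (η h) = h) (hηborn : Bornologous η) (ρ k : ℝ) :
    ∃ S : Finset I, ∀ t s s' : H, dist t s ≤ ρ → dist t s' ≤ ρ →
      ∀ (u : W) (n : ε.ker), dist 1 u ≤ k → (n : W) = η s * u * (η s')⁻¹ →
        mulSupport (φ n : I → G) ⊆ (t • ·) '' (S : Set I) := by
  obtain ⟨P, -, hP⟩ := hηborn (|ρ| + 1) (by positivity)
  have hK : (Set.image2 (fun x z : W => x * z) (Set.image2 (fun x y : W => x * y)
      (closedBall 1 P) (closedBall 1 k)) ((·⁻¹) '' closedBall 1 P)).Finite :=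
    ((hWproper 1 P).image2 _ (hWproper 1 k)).image2 _ ((hWproper 1 P).image _)
  obtain ⟨S, hS⟩ := exists_finset_mulSupport_subset φ hK
  refine ⟨S, fun t s s' hs hs' u n hu hn => ?_⟩
  have hball : ∀ s, dist t s ≤ ρ → (η t)⁻¹ * η s ∈ closedBall 1 P := fun s hs => by
    rw [mem_closedBall, dist_comm, hWinv.dist_one]
    exact (hP t s (by linarith [le_abs_self ρ])).le
  have hn₀ : n = MulAut.conjNormal (η t) (MulAut.conjNormal (η t)⁻¹ n) := by
    rw [map_inv, MulAut.apply_inv_self]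
  have hn₁ : ((MulAut.conjNormal (η t)⁻¹ n : ε.ker) : W)
      = (η t)⁻¹ * η s * u * ((η t)⁻¹ * η s')⁻¹ := by
    rw [MulAut.conjNormal_apply, hn]
    group
  have h := mulSupport_conjNormal_subset φ hconj (η t) (MulAut.conjNormal (η t)⁻¹ n)
  rw [← hn₀, hηsec] at h
  refine h.trans (Set.image_mono (hS _ ?_))
  rw [hn₁]
  exact ⟨_, ⟨_, hball s hs, u, by rwa [mem_closedBall, dist_comm], rfl⟩, _,
    ⟨_, hball s' hs', rfl⟩, rfl⟩

/-- At every scale `k` there are a colouring of `H` with representative points and a number `n`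
such that moves of size at most `k` within a cluster affect at most `n` coordinates. -/
lemma exists_level (hWproper : ProperMet W) (hWinv : LeftInvariant W) (hHinv : LeftInvariant H)
    {d : ℕ} (hH : AsdimLE H d)
    (hconj : ∀ (w : W) (i : I),
      (fun x => w * x * w⁻¹) ''
          {x : W | ∃ hx : x ∈ ε.ker, Function.mulSupport ((φ ⟨x, hx⟩ : I → G)) ⊆ {i}} =
        {x : W | ∃ hx : x ∈ ε.ker, Function.mulSupport ((φ ⟨x, hx⟩ : I → G)) ⊆ {ε w • i}})
    {η : H → W} (hηsec : ∀ h : H, ε (η h) = h) (hηborn : Bornologous η) (k : ℝ) :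
    ∃ (χ : H → Fin (d + 1)) (b : H → H) (ρ : ℝ) (S : Finset I), (∀ h, dist (b h) h ≤ ρ) ∧
      (∀ w w' : W, dist w w' < k → χ (ε w) = χ (ε w') → b (ε w) = b (ε w')) ∧
      ∀ t s s' : H, dist t s ≤ ρ → dist t s' ≤ ρ →
        ∀ (u : W) (n : ε.ker), dist 1 u ≤ k → (n : W) = η s * u * (η s')⁻¹ →
          mulSupport (φ n : I → G) ⊆ (t • ·) '' (S : Set I) := by
  obtain ⟨k', hk', hε⟩ := bornologous_of_hom hWproper hWinv hHinv ε (|k| + 1) (by positivity)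
  obtain ⟨ρ, χ, b, hb, hχ⟩ := hH.exists_coloring hk'
  obtain ⟨S, hS⟩ :=
    exists_finset_mulSupport_subset_smul φ hWproper hWinv hconj hηsec hηborn ρ k
  exact ⟨χ, b, ρ, S, fun h => by rw [dist_comm]; exact hb h,
    fun w w' hww' h => hχ _ _ h (hε w w' (by linarith [le_abs_self k])), hS⟩

end Levels

/-- Asymptotic property C in terms of colourings: every colour class `c` splits into pieces
of bounded diameter which are `R c`-disjoint. -/
lemma HasAPC.of_coloring {X : Type*} [MetricSpace X]
    (h : ∀ R : ℕ → ℝ, (∀ i, 0 < R i) → StrictMono R → ∃ (N : ℕ) (M : ℝ) (col : X → ℕ),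
      (∀ x, col x ≤ N) ∧ ∀ c, ∃ E : Setoid X,
        (∀ x y, col x = c → col y = c → dist x y < R c → E x y) ∧
        ∀ x y, col x = c → col y = c → E x y → dist x y ≤ M) : HasAPC X := by
  intro R hR hmono
  obtain ⟨N, M, col, hcol, hE⟩ := h R hR hmono
  choose E hE hE' using hE
  refine ⟨N, fun c => {U | ∃ x, col x = c ∧ U = {y | col y = c ∧ E c x y}}, fun c => ?_,
    fun c => ?_, ?_⟩
  · refine ⟨max M 1, by positivity, ?_⟩
    rintro _ ⟨x, hx, rfl⟩ y ⟨hy, hxy⟩ z ⟨hz, hxz⟩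
    exact (hE' c y z hy hz ((E c).trans ((E c).symm hxy) hxz)).trans (le_max_left _ _)
  · rintro _ ⟨x, hx, rfl⟩ _ ⟨x', hx', rfl⟩ hne y ⟨hy, hxy⟩ y' ⟨hy', hxy'⟩
    by_contra! hlt
    have hxx' := (E c).trans ((E c).trans hxy (hE c y y' hy hy' hlt)) ((E c).symm hxy')
    refine hne (Set.ext fun z => and_congr_right fun _ => ⟨fun hz => ?_, fun hz => ?_⟩)
    · exact (E c).trans ((E c).symm hxx') hz
    · exact (E c).trans hxx' hz
  · refine Set.eq_univ_of_forall fun x => Set.mem_iUnion.2 ⟨⟨col x, Nat.lt_succ_of_le (hcol x)⟩,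
      {y | col y = col x ∧ E (col x) x y}, ⟨x, rfl, rfl⟩, rfl, (E (col x)).refl x⟩

/-- An extension of a group `H` of finite asymptotic dimension by `⊕_{i ∈ I} G`, in which
conjugation permutes the factors according to an action of `H` on `I` and which has a bornologous
section, has asymptotic property C if `G` has finite asymptotic dimension and the
`(m,0)`-DTUT property. -/
theorem hasAPC_of_extension {G H W I : Type*} [Group G] [Group H] [Group W]
    [MetricSpace G] [MetricSpace H] [MetricSpace W] [MulAction H I]
    (hGproper : ProperMet G) (hGinv : LeftInvariant G)
    (hHproper : ProperMet H) (hHinv : LeftInvariant H)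
    (hWproper : ProperMet W) (hWinv : LeftInvariant W)
    {m : ℕ} (hGfad : HasFiniteAsdim G) (hGdtut : DTUT G m 0) (hHfad : HasFiniteAsdim H)
    {ε : W →* H} (φ : ε.ker ≃* finSuppSubgroup I G)
    (hconj : ∀ (w : W) (i : I),
      (fun x => w * x * w⁻¹) ''
          {x : W | ∃ hx : x ∈ ε.ker, Function.mulSupport ((φ ⟨x, hx⟩ : I → G)) ⊆ {i}} =
        {x : W | ∃ hx : x ∈ ε.ker, Function.mulSupport ((φ ⟨x, hx⟩ : I → G)) ⊆ {ε w • i}})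
    {η : H → W} (hηsec : ∀ h : H, ε (η h) = h) (hηborn : Bornologous η) :
    HasAPC W := by
  classical
  obtain ⟨a, ha⟩ := hGfad
  obtain ⟨d, hd⟩ := hHfad
  obtain ⟨f, hf⟩ := exists_coloring_sigma ha hGdtut
  have hlevel := exists_level φ hWproper hWinv hHinv hd hconj hηsec hηborn
  choose χ b ρ S hρ hχ hS using hlevel
  refine HasAPC.of_coloring fun R _ hRmono => ?_
  -- the scales `k i`, chosen together with bounds `ν i` for the numbers of coordinates affected
  -- at the previous scales and with the numbers `tot i` of colours used at the previous levels
  let M : ℕ := (d + 1) ^ (m + 1)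
  let st : ℕ → ℕ × ℕ := fun i => Nat.rec (0, 0)
    (fun _ p => (max p.1 (S (R (p.2 + M * f p.1))).card, p.2 + M * f p.1)) i
  let ν : ℕ → ℕ := fun i => (st i).1
  let tot : ℕ → ℕ := fun i => (st i).2
  let k : ℕ → ℝ := fun i => R (tot (i + 1))
  have htot_succ : ∀ i, tot (i + 1) = tot i + M * f (ν i) := fun _ => rfl
  have hν_succ : ∀ i, ν (i + 1) = max (ν i) (S (k i)).card := fun _ => rfl
  have htot : Monotone tot := monotone_nat_of_le_succ fun i => by rw [htot_succ]; omega
  have hk : Monotone k := fun i j hij => hRmono.monotone (htot (Nat.succ_le_succ hij))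
  -- coordinates on `W`
  let P : Finset H := (hHproper 1 (ρ (k m))).toFinset
  let g : W → H := fun w => b (k m) (ε w)
  let s : W → H := fun w => (g w)⁻¹ * ε w
  have hgs : ∀ w, g w * s w = ε w := fun w => mul_inv_cancel_left _ _
  have hsP : ∀ w, s w ∈ P := fun w => by
    rw [Set.Finite.mem_toFinset, mem_closedBall, dist_comm, hHinv.dist_one]
    exact hρ _ _
  let z : W → ε.ker := fun w => ⟨(η (g w))⁻¹ * w * (η (s w))⁻¹, by
    rw [MonoidHom.mem_ker, map_mul, map_mul, map_inv, map_inv, hηsec, hηsec, ← hgs w]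
    group⟩
  have hz : ∀ w w', g w = g w' →
      (((z w)⁻¹ * z w' : ε.ker) : W) = η (s w) * (w⁻¹ * w') * (η (s w'))⁻¹ := by
    intro w w' h
    simp only [z, Subgroup.coe_mul, Subgroup.coe_inv, ← h]
    group
  have hφz : ∀ w w' j, (φ ((z w)⁻¹ * z w') : I → G) j
      = ((φ (z w) : I → G) j)⁻¹ * (φ (z w') : I → G) j := by
    intro w w' j
    rw [map_mul, map_inv]
    rfl
  -- the coordinates affected at the different scales
  let Q : H → H → ℕ → Finset I := fun g s i =>
    (S (k i)).image ((g⁻¹ * b (k i) (g * s)) • ·)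
  let J : H → H → Fin (m + 1) → Finset I := fun g s i =>
    (Q g s i).filter fun j => ∀ r : Fin (m + 1), i ≤ r → j ∈ Q g s r
  have hJ_mem : ∀ g s i j, j ∈ J g s i ↔ ∀ r : Fin (m + 1), i ≤ r → j ∈ Q g s r := fun g s i j =>
    ⟨fun h => (Finset.mem_filter.1 h).2, fun h => Finset.mem_filter.2 ⟨h i le_rfl, h⟩⟩
  have hJ_mono : ∀ g s, Monotone (J g s) := fun g s i i' hi j hj =>
    (hJ_mem _ _ _ _).2 fun r hr => (hJ_mem _ _ _ _).1 hj r (hi.trans hr)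
  have hJ_card : ∀ g s i, (J g s i).card ≤ (S (k i)).card := fun g s i =>
    (Finset.card_filter_le _ _).trans Finset.card_image_le
  -- colourings of the fibres
  have hPfin : (η '' (P : Set H)).Finite := P.finite_toSet.image _
  have hPfin' : ((·⁻¹) '' (η '' (P : Set H))).Finite := hPfin.image _
  obtain ⟨κ, hκ, hκdist⟩ := exists_dist_one_le φ
    ((hPfin.image2 (fun x u : W => x * u) (hWproper 1 (k m))).image2 (fun x y : W => x * y) hPfin')
  obtain ⟨ρ', -, hcol⟩ := hf (I := I) (S (k m)).card P κ hκ
  have hcol' := fun g => hcol (fun i => ν i) (J g) (hJ_mono g) (fun s => hJ_card g s _)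
    fun s i => (hJ_card g s _).trans (le_max_right _ _)
  choose col hcol_lt hzero using hcol'
  choose E hE hE' using hzero
  obtain ⟨B, hB⟩ := (((hPfin'.image2 (fun x u : W => x * u)
    ((finite_setOf_mulSupport_subset φ hGproper (S (k m)) ρ').image Subtype.val)).image2
      (fun x y : W => x * y) hPfin).image (dist (1 : W))).bddAbove
  -- the colouring of `W`
  let pt : W → (I → G) × H := fun w => (φ (z w), s w)
  let q : W → Fin (m + 1) × ℕ := fun w => col (g w) (pt w)
  let χH : W → Fin (m + 1) → Fin (d + 1) := fun w i => χ (k i) (ε w)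
  let e : (Fin (m + 1) → Fin (d + 1)) ≃ Fin M :=
    Fintype.equivFinOfCardEq (by rw [Fintype.card_fun, Fintype.card_fin, Fintype.card_fin])
  let idx : W → ℕ := fun w => tot (q w).1 + ((e (χH w) : ℕ) + M * (q w).2)
  have hidx_lt : ∀ w, idx w < tot ((q w).1 + 1) := by
    intro w
    have h1 : (q w).2 + 1 ≤ f (ν (q w).1) := hcol_lt (g w) (pt w) (hsP w)
    have h2 := Nat.mul_le_mul_left M h1
    have h3 := (e (χH w)).2
    rw [htot_succ]
    simp only [idx]
    rw [mul_add, mul_one] at h2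
    omega
  have hidx_inj : ∀ w w', idx w = idx w' → q w = q w' ∧ χH w = χH w' := by
    have hle : ∀ w w', idx w = idx w' → ((q w').1 : ℕ) ≤ (q w).1 := fun w w' h => by
      by_contra! hlt
      have h1 : tot ((q w).1 + 1) ≤ tot (q w').1 := htot hlt
      have h2 := hidx_lt w
      have h3 : tot (q w').1 ≤ idx w' := Nat.le_add_right _ _
      omega
    intro w w' h
    have h1 : (q w).1 = (q w').1 := Fin.ext (le_antisymm (hle w' w h.symm) (hle w w' h))
    have h2 : (e (χH w) : ℕ) + M * (q w).2 = (e (χH w') : ℕ) + M * (q w').2 := by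
      simp only [idx, h1] at h
      omega
    have hM : 0 < M := by positivity
    have h3 := congrArg (· / M) h2
    have h4 := congrArg (· % M) h2
    simp only [Nat.add_mul_div_left _ _ hM, Nat.add_mul_mod_self_left,
      Nat.div_eq_of_lt (Fin.is_lt _), Nat.mod_eq_of_lt (Fin.is_lt _), zero_add] at h3 h4
    exact ⟨Prod.ext h1 h3, e.injective (Fin.ext h4)⟩
  refine ⟨tot (m + 1), B, idx, fun w => (hidx_lt w).le.trans (htot (q w).1.2), fun c => ?_⟩
  by_cases hc : ∃ w, idx w = c
  swap
  · exact ⟨⊤, fun w _ hw => absurd ⟨w, hw⟩ hc, fun w _ hw => absurd ⟨w, hw⟩ hc⟩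
  obtain ⟨w₀, rfl⟩ := hc
  let E₀ : Setoid W :=
    { r := fun w w' => g w = g w' ∧ E (g w) (q w₀) (pt w) (pt w')
      iseqv :=
        { refl := fun w => ⟨rfl, (E _ _).refl _⟩
          symm := fun h => ⟨h.1.symm, h.1 ▸ (E _ _).symm h.2⟩
          trans := fun h h' => ⟨h.1.trans h'.1, (E _ _).trans h.2 (h.1 ▸ h'.2)⟩ } }
  refine ⟨E₀, fun w w' hw hw' hww' => ?_, fun w w' hw hw' hww' => ?_⟩
  · obtain ⟨hq, hχw⟩ := hidx_inj w w₀ hw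
    obtain ⟨hq', hχw'⟩ := hidx_inj w' w₀ hw'
    have hdist : ∀ r : Fin (m + 1), (q w₀).1 ≤ r → dist w w' < k r := fun r hr =>
      (hww'.trans_le (hRmono.monotone (hidx_lt w₀).le)).trans_le (hk hr)
    have hb : ∀ r : Fin (m + 1), (q w₀).1 ≤ r → b (k r) (ε w) = b (k r) (ε w') := fun r hr =>
      hχ _ _ _ (hdist r hr) (congrFun (hχw.trans hχw'.symm) r)
    have hg : g w = g w' := hb (Fin.last m) (Fin.le_last _)
    refine ⟨hg, hE _ _ _ ⟨hsP w, hq⟩ _ ⟨hsP w', by rw [hg]; exact hq'⟩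
      ⟨?_, fun j hj => ?_, fun j => ?_⟩⟩
    · ext j
      simp only [pt, hJ_mem]
      refine forall₂_congr fun r hr => ?_
      simp only [Q]
      rw [hgs w, hg, hgs w', hb r hr]
    · simp only [pt, hJ_mem, not_forall] at hj
      obtain ⟨r, hr, hj⟩ := hj
      have ht : ∀ v, g v = g w → b (k r) (ε v) = b (k r) (ε w) →
          dist ((g w)⁻¹ * b (k r) (ε w)) (s v) ≤ ρ (k r) := fun v hv hv' => by
        simp only [s]
        rw [hv, hHinv, ← hv']
        exact hρ _ _
      have hsupp := hS (k r) _ _ _ (ht w rfl rfl) (ht w' hg.symm (hb r hr).symm) (w⁻¹ * w') _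
        (by rw [hWinv.dist_one]; exact (hdist r hr).le) (hz w w' hg)
      have h1 : (φ ((z w)⁻¹ * z w') : I → G) j = 1 := by
        by_contra hne
        refine hj ?_
        have := hsupp hne
        simp only [Q, hgs w]
        rwa [← Finset.mem_coe, Finset.coe_image]
      rw [hφz] at h1
      exact inv_mul_eq_one.1 h1
    · rw [← hGinv.dist_one]
      have := hκdist ((z w)⁻¹ * z w') (by
        rw [hz w w' hg]
        exact ⟨_, ⟨_, ⟨_, hsP w, rfl⟩, w⁻¹ * w', by
          rw [mem_closedBall, dist_comm, hWinv.dist_one]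
          exact (hdist (Fin.last m) (Fin.le_last _)).le, rfl⟩, _,
          ⟨_, ⟨_, hsP w', rfl⟩, rfl⟩, rfl⟩) j
      rwa [hφz] at this
  · obtain ⟨hq, -⟩ := hidx_inj w w₀ hw
    obtain ⟨hq', -⟩ := hidx_inj w' w₀ hw'
    obtain ⟨hg, hww'⟩ := hww'
    have hnear := hE' _ _ _ ⟨hsP w, hq⟩ _ ⟨hsP w', by rw [hg]; exact hq'⟩ hww'
    have hmem : (z w)⁻¹ * z w' ∈ {n : ε.ker | mulSupport (φ n : I → G) ⊆ S (k m) ∧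
        ∀ j, dist 1 ((φ n : I → G) j) ≤ ρ'} := by
      refine ⟨fun j hj => ?_, fun j => ?_⟩
      · have hjJ : j ∈ J (g w) (s w) (q w₀).1 := by
          by_contra hjJ
          refine hj ?_
          rw [hφz]
          exact inv_mul_eq_one.2 (hnear.2.1 j hjJ)
        have := (hJ_mem _ _ _ _).1 hjJ (Fin.last m) (Fin.le_last _)
        simpa [Q, hgs w, g] using this
      · rw [hφz, hGinv.dist_one]
        exact hnear.2.2 j
    rw [← hWinv.dist_one]
    refine hB ⟨_, ⟨_, ⟨_, ⟨_, ⟨_, hsP w, rfl⟩, rfl⟩, _, ⟨_, hmem, rfl⟩, rfl⟩, _, ⟨_, hsP w', rfl⟩,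
      ?_⟩, rfl⟩
    simp only [hz w w' hg]
    group

end APC


/-- Let `G`, `H` be countable discrete groups with proper left-invariant
metrics, where `G` has finite asymptotic dimension and the `(m,0)`-DTUT property, and `H`
is an FC-group with finite asymptotic dimension.  Let `W` be a wreath-like product of `G`
and `H` corresponding to an action `H ↷ I` with finitely many orbits, and suppose there is
a symmetric transversal `T` for `⊕_{i ∈ I} G` in `W` whose transversal map `η : H → T` is
unital and bornologous.  Then `W`, equipped with a proper left-invariant metric associated
with `T`, has asymptotic property C. -/
theorem wreath_like_product_hasAPC
    {G H W I : Type*} [Group G] [Group H] [Group W]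
    [Countable G] [Countable H]
    [MetricSpace G] [MetricSpace H] [MetricSpace W]
    [MulAction H I]
    -- the metrics on `G` and `H` are proper and left-invariant
    (hGproper : ProperMet G) (hGinv : LeftInvariant G)
    (hHproper : ProperMet H) (hHinv : LeftInvariant H)
    -- `G` has finite asymptotic dimension and the `(m,0)`-DTUT property
    (m : ℕ) (hGfad : HasFiniteAsdim G) (hGdtut : DTUT G m 0)
    -- `H` is an FC-group with finite asymptotic dimension
    (hHFC : IsFCGroup H) (hHfad : HasFiniteAsdim H)
    -- the action `H ↷ I` has finitely many orbits
    (horb : Finite (MulAction.orbitRel.Quotient H I))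
    -- `W` is a wreath-like product: an extension `1 → ⊕_{i∈I} G → W → H → 1` in which
    -- conjugation by `w ∈ W` maps the factor `G_i` onto the factor `G_{ε(w)•i}`
    (ε : W →* H) (hsurj : Function.Surjective ε)
    (φ : ε.ker ≃* finSuppSubgroup I G)
    (hconj : ∀ (w : W) (i : I),
      (fun x => w * x * w⁻¹) ''
          {x : W | ∃ hx : x ∈ ε.ker, Function.mulSupport ((φ ⟨x, hx⟩ : I → G)) ⊆ {i}} =
        {x : W | ∃ hx : x ∈ ε.ker, Function.mulSupport ((φ ⟨x, hx⟩ : I → G)) ⊆ {ε w • i}})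
    -- `T` is a symmetric transversal for `ker ε = ⊕_{i∈I} G` in `W`
    (T : Set W) (hT1 : (1 : W) ∈ T) (hTsymm : ∀ t ∈ T, t⁻¹ ∈ T)
    (hTtransversal : ∀ h : H, ∃! t : W, t ∈ T ∧ ε t = h)
    -- the transversal map `η : H → T` is unital and bornologous
    (η : H → W) (hηT : ∀ h : H, η h ∈ T) (hηsec : ∀ h : H, ε (η h) = h)
    (hηunital : η 1 = 1) (hηborn : Bornologous η)
    -- a choice of base point `i_{α,0}` in each orbit of `H ↷ I`
    (rep : MulAction.orbitRel.Quotient H I → I)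
    (hrep : ∀ α, Quotient.mk (MulAction.orbitRel H I) (rep α) = α)
    -- `d_W` is a proper left-invariant metric on `W` associated with `T`: the weighted
    -- word metric for the generating set consisting of the δ-functions supported at the
    -- orbit representatives (weighted by the length of their value in `G`) together with
    -- the transversal elements `η h` (weighted by the length of `h` in `H`)
    (hWproper : ProperMet W) (hWinv : LeftInvariant W)
    (hWdist : ∀ u v : W, dist u v =
      sInf {c : ℝ | ∃ L : List (W × ℝ),
        (∀ p ∈ L,
          (∃ hp : p.1 ∈ ε.ker, ∃ α : MulAction.orbitRel.Quotient H I,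
              Function.mulSupport ((φ ⟨p.1, hp⟩ : I → G)) ⊆ {rep α} ∧
              p.2 = dist (1 : G) ((φ ⟨p.1, hp⟩ : I → G) (rep α))) ∨
          (∃ h : H, p.1 = η h ∧ p.2 = dist (1 : H) h)) ∧
        (L.map Prod.fst).prod = u⁻¹ * v ∧ (L.map Prod.snd).sum = c}) :
    HasAPC W := by
  exact hasAPC_of_extension hGproper hGinv hHproper hHinv hWproper hWinv hGfad hGdtut hHfad φ hconj
    hηsec hηborn
end

section
/- Let G be a finitely generated group with a finite generating set S whose growth function r ↦ |B_S(1,r)| (the cardinality of the ball of radius r about the identity in the word metric) is bounded above by a polynomial in r. Then G, equipped with the word metric of S, has the (m,0)-DTUT property for some m ∈ ℕ. -/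
open Metric Set Function

open APC Set

namespace APC

/-- Every set with pairwise distances greater than `δ` lies in a maximal one, which is a
`δ`-net. -/
theorem exists_separated_net {X : Type*} [MetricSpace X] {δ : ℝ} (hδ : 0 ≤ δ) {A : Set X}
    (hA : A.Pairwise fun x y => δ < dist x y) :
    ∃ B, A ⊆ B ∧ (B.Pairwise fun x y => δ < dist x y) ∧ ∀ x, ∃ b ∈ B, dist x b ≤ δ := by
  obtain ⟨B, hAB, hB⟩ := zorn_subset_nonempty
    {B : Set X | B.Pairwise fun x y => δ < dist x y} (by
      intro c hc hchain _
      refine ⟨⋃₀ c, ?_, fun s hs => subset_sUnion_of_mem hs⟩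
      exact (Set.pairwise_sUnion hchain.directedOn).2 hc) A hA
  refine ⟨B, hAB, hB.1, fun x => ?_⟩
  by_contra! hx
  have hins : insert x B ∈ {B : Set X | B.Pairwise fun x y => δ < dist x y} := by
    refine hB.1.insert fun b hb _ => ⟨hx b hb, ?_⟩
    rw [dist_comm]; exact hx b hb
  have hxB : x ∈ B := hB.2 hins (subset_insert x B) (mem_insert x B)
  have := hx x hxB
  rw [dist_self] at this
  exact absurd this (not_lt.2 hδ)

/-- Greedy colouring of a relation of degree at most `K` on a subset. -/
theorem exists_greedy_coloring {X : Type*} (adj : X → X → Prop) (hsymm : ∀ x y, adj x y → adj y x)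
    (Z : Set X) (K : ℕ) (hK : ∀ x, {z ∈ Z | adj x z}.Finite ∧ {z ∈ Z | adj x z}.ncard ≤ K) :
    ∃ c : X → ℕ, (∀ x, c x ≤ K) ∧ ∀ x ∈ Z, ∀ y ∈ Z, x ≠ y → adj x y → c x ≠ c y := by
  let c : X → ℕ := (IsWellFounded.wf (r := @WellOrderingRel X)).fix fun x ih =>
    sInf {n | ∀ y (hy : WellOrderingRel y x), y ∈ Z → adj x y → ih y hy ≠ n}
  have hc : ∀ x, c x = sInf {n | ∀ y, WellOrderingRel y x → y ∈ Z → adj x y → c y ≠ n} :=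
    fun x => WellFounded.fix_eq _ _ x
  have hfree : ∀ x, ∃ n ≤ K, ∀ y, WellOrderingRel y x → y ∈ Z → adj x y → c y ≠ n := by
    intro x
    have hcard : ((hK x).1.toFinset.image c).card < (Finset.range (K + 1)).card := by
      rw [Finset.card_range]
      refine Nat.lt_succ_of_le (Finset.card_image_le.trans ?_)
      rw [← Set.ncard_eq_toFinset_card _ (hK x).1]
      exact (hK x).2
    obtain ⟨n, hn, hn'⟩ := Finset.exists_mem_notMem_of_card_lt_card hcard
    refine ⟨n, Nat.lt_succ_iff.1 (Finset.mem_range.1 hn), fun y _ hyZ hxy hyn => hn' ?_⟩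
    exact Finset.mem_image.2 ⟨y, by simpa using ⟨hyZ, hxy⟩, hyn⟩
  have hspec : ∀ x y, WellOrderingRel y x → y ∈ Z → adj x y → c y ≠ c x := by
    intro x
    obtain ⟨n, -, hn⟩ := hfree x
    have hmem := Nat.sInf_mem
      (s := {n | ∀ y, WellOrderingRel y x → y ∈ Z → adj x y → c y ≠ n}) ⟨n, hn⟩
    rw [← hc x] at hmem
    exact hmem
  refine ⟨c, fun x => ?_, fun x hx y hy hne hxy => ?_⟩
  · obtain ⟨n, hnK, hn⟩ := hfree x
    rw [hc x]
    refine le_trans (Nat.sInf_le ?_) hnK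
    exact hn
  · rcases trichotomous_of WellOrderingRel x y with h | h | h
    · exact hspec y x h hx (hsymm _ _ hxy)
    · exact absurd h hne
    · exact (hspec x y h hy hxy).symm

/-- A set with at most `K` elements is enumerated by the slots `0, …, K`, with one prescribed
value. -/
theorem exists_enumeration_with_value {α : Type*} (T : Set α) {K : ℕ} (hT : T.Finite)
    (hcard : T.ncard ≤ K) (a : ℕ) (t : α) :
    ∃ σ : ℕ → α, σ a = t ∧ ∀ s ∈ T, ∃ b ≤ K, σ b = s := by
  obtain ⟨e, he⟩ : ∃ e : ℕ → α, ∀ s ∈ T, ∃ b < K, e b = s := by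
    let L := hT.toFinset.toList
    have hL : L.length ≤ K := by
      rw [Finset.length_toList, ← Set.ncard_eq_toFinset_card _ hT]
      exact hcard
    refine ⟨fun b => L.getD b t, fun s hs => ?_⟩
    obtain ⟨b, hb, hbs⟩ := List.mem_iff_getElem.1
      (show s ∈ L by simpa [L] using hs)
    exact ⟨b, hb.trans_le hL, by simp [hb, hbs]⟩
  refine ⟨fun b => if b = a then t else if b < a then e b else e (b - 1), by simp, fun s hs => ?_⟩
  obtain ⟨b, hbK, hb⟩ := he s hs
  by_cases hba : b < a
  · exact ⟨b, hbK.le, by simp [hba, hba.ne, hb]⟩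
  · refine ⟨b + 1, hbK, ?_⟩
    have h1 : b + 1 ≠ a := by omega
    have h2 : ¬ b + 1 < a := by omega
    simp [h1, h2, hb]

/-- Slot assignments covering the small sets `T x` and realising every value in every slot along
an infinite set. -/
theorem exists_slot_assignment {X α : Type*} [Countable α] [Nonempty α] {A : Set X}
    (hA : A.Infinite) (T : X → Set α) {K : ℕ} (hT : ∀ x, (T x).Finite ∧ (T x).ncard ≤ K) :
    ∃ τ : X → ℕ → α, (∀ x, ∀ t ∈ T x, ∃ b ≤ K, τ x b = t) ∧ ∀ b t, ∃ x ∈ A, τ x b = t := by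
  choose σ hσ hσT using fun x (p : ℕ × α) =>
    exists_enumeration_with_value (T x) (hT x).1 (hT x).2 p.1 p.2
  obtain ⟨g, hg⟩ := exists_surjective_nat (ℕ × α)
  let ι : ℕ → X := fun n => (hA.natEmbedding A n : X)
  have hι : Function.Injective ι := Subtype.val_injective.comp (hA.natEmbedding A).injective
  refine ⟨fun x => σ x (g (Function.invFun ι x)), fun x t ht => hσT x _ t ht, fun b t => ?_⟩
  obtain ⟨n, hn⟩ := hg (b, t)
  refine ⟨ι n, (hA.natEmbedding A n).2, ?_⟩
  have := hσ (ι n) (b, t)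
  simpa [Function.leftInverse_invFun hι n, hn] using this

/-- A metric space is `K`-doubling at scale `r` when every `2r`-separated set meets each ball of
radius `5r` in at most `K` points. -/
def DoublingAt (X : Type*) [MetricSpace X] (K r : ℕ) : Prop :=
  ∀ Z : Set X, (Z.Pairwise fun x y => 2 * (r : ℝ) < dist x y) →
    ∀ x, {z ∈ Z | dist x z ≤ 5 * r}.Finite ∧ {z ∈ Z | dist x z ≤ 5 * r}.ncard ≤ K

/-- The ball around `z` of radius `ρ` with the `ρ + κ`-balls around all earlier points of `Y`
removed. -/
def carvedCell {X : Type*} [MetricSpace X] (Y : Set X) (ρ κ : ℝ) (z : X) : Set X :=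
  {x | dist x z ≤ ρ ∧ ∀ y ∈ Y, WellOrderingRel y z → ρ + κ < dist x y}

theorem le_dist_of_mem_carvedCell {X : Type*} [MetricSpace X] {Y : Set X} {ρ κ : ℝ} {z w x y : X}
    (hz : z ∈ Y) (hw : w ∈ Y) (hne : z ≠ w) (hx : x ∈ carvedCell Y ρ κ z)
    (hy : y ∈ carvedCell Y ρ κ w) : κ ≤ dist x y := by
  rcases trichotomous_of WellOrderingRel z w with h | h | h
  · linarith [hx.1, hy.2 z hz h, dist_triangle y x z, dist_comm x y]
  · exact absurd h hne
  · linarith [hy.1, hx.2 w hw h, dist_triangle x y w]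

/-- Points outside all the shells around `Y` lie in one of the carved cells. -/
theorem exists_mem_carvedCell {X : Type*} [MetricSpace X] {Y : Set X} {ρ κ : ℝ} {x : X}
    (hnet : ∃ z ∈ Y, dist x z ≤ ρ) (hx : ∀ z ∈ Y, ρ < dist x z → ρ + κ < dist x z) :
    ∃ z ∈ Y, x ∈ carvedCell Y ρ κ z := by
  obtain ⟨z, ⟨hz, hxz⟩, hmin⟩ := (IsWellFounded.wf (r := @WellOrderingRel X)).has_min
    {z | z ∈ Y ∧ dist x z ≤ ρ} hnet
  refine ⟨z, hz, hxz, fun y hy hyz => hx y hy ?_⟩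
  by_contra! h
  exact hmin y ⟨hy, h⟩ hyz

/-- At a doubling scale, an infinite space with finite balls is covered by finitely many
infinite families of well-separated balls. -/
theorem DoublingAt.exists_separated_cover {X : Type*} [MetricSpace X] [Infinite X]
    (hfin : ∀ (x : X) (R : ℝ), (Metric.closedBall x R).Finite) {K r : ℕ}
    (hr : DoublingAt X K r) :
    ∃ Z : ℕ → Set X, (∀ j, (Z j).Infinite) ∧
      (∀ j, (Z j).Pairwise fun x y => 5 * (r : ℝ) < dist x y) ∧
      ∀ x, ∃ j ≤ K, ∃ z ∈ Z j, dist x z ≤ 2 * r := by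
  obtain ⟨Y, -, hYsep, hYnet⟩ := exists_separated_net (X := X) (δ := 2 * r) (by positivity)
    (Set.pairwise_empty _)
  obtain ⟨c, hcK, hc⟩ := exists_greedy_coloring (fun x y : X => dist x y ≤ 5 * r)
    (fun x y h => by rwa [dist_comm]) Y K (hr Y hYsep)
  choose Z hYZ hZsep hZnet using fun j : ℕ =>
    exists_separated_net (X := X) (δ := 5 * r) (by positivity) (A := {y ∈ Y | c y = j})
      (fun x hx y hy hne => by
        by_contra! h
        exact hc x hx.1 y hy.1 hne h (hx.2.trans hy.2.symm))
  refine ⟨Z, fun j hj => ?_, hZsep, fun x => ?_⟩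
  · refine Set.infinite_univ ((hj.biUnion fun z _ => hfin z (5 * r)).subset fun x _ => ?_)
    obtain ⟨b, hb, hxb⟩ := hZnet j x
    exact Set.mem_biUnion hb hxb
  · obtain ⟨z, hz, hxz⟩ := hYnet x
    exact ⟨c z, hcK z, z, hYZ _ ⟨hz, rfl⟩, hxz⟩

/-- For shells around a separated set whose radii grow in large steps, only boundedly many radii
have a shell meeting a given small ball. -/
theorem DoublingAt.finite_shells {X : Type*} [MetricSpace X] {K N : ℕ}
    (hN : DoublingAt X K N) {Y : Set X} (hY : Y.Pairwise fun x y => 2 * (N : ℝ) < dist x y)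
    {κ δ W : ℝ} (hW : κ + 2 * δ ≤ W) (H : ℕ+) (hNH : H * W + κ + δ ≤ 3 * N) (hW0 : 0 ≤ W) (u : X) :
    {t : ℕ+ | t ≤ H ∧ ∃ z ∈ Y, ∃ x, dist x u ≤ δ ∧ 2 * N + t * W < dist x z ∧
      dist x z ≤ 2 * N + t * W + κ}.Finite ∧
    {t : ℕ+ | t ≤ H ∧ ∃ z ∈ Y, ∃ x, dist x u ≤ δ ∧ 2 * N + t * W < dist x z ∧
      dist x z ≤ 2 * N + t * W + κ}.ncard ≤ K := by
  refine ⟨(Set.finite_Iic H).subset fun t ht => ht.1, ?_⟩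
  refine le_trans ?_ (hN Y hY u).2
  have : Nonempty X := ⟨u⟩
  choose! z hzY x hxu hlo hhi using fun (t : ℕ+) (ht : t ∈ {t : ℕ+ | t ≤ H ∧ ∃ z ∈ Y, ∃ x,
    dist x u ≤ δ ∧ 2 * N + t * W < dist x z ∧ dist x z ≤ 2 * N + t * W + κ}) => ht.2
  have hinj : ∀ t t' : ℕ+, t < t' → ∀ w : X, ∀ x y : X, dist x u ≤ δ → dist y u ≤ δ →
      dist x w ≤ 2 * N + t * W + κ → 2 * N + t' * W < dist y w → False := by
    intro t t' htt w x y hx hy hxw hyw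
    have h1 : (t : ℝ) + 1 ≤ t' := by exact_mod_cast htt
    have h2 := mul_le_mul_of_nonneg_right h1 hW0
    linarith [dist_triangle y u w, dist_triangle u x w, dist_comm u x]
  refine Set.ncard_le_ncard_of_injOn z (fun t ht => ⟨hzY t ht, ?_⟩) ?_ (hN Y hY u).1
  · have h1 : (t : ℝ) ≤ H := by exact_mod_cast ht.1
    have h2 := mul_le_mul_of_nonneg_right h1 hW0
    linarith [hhi t ht, hxu t ht, dist_triangle u (x t) (z t), dist_comm u (x t)]
  · intro t ht t' ht' heq
    rcases lt_trichotomy t t' with h | h | h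
    · exact (hinj t t' h (z t) _ _ (hxu t ht) (hxu t' ht') (hhi t ht) (heq ▸ hlo t' ht')).elim
    · exact h
    · exact (hinj t' t h (z t) _ _ (hxu t' ht') (hxu t ht) (heq ▸ hhi t' ht') (hlo t ht)).elim

/-- An infinite space with finite balls that is uniformly doubling at arbitrarily large scales has
the `(1,0)`-DTUT property. -/
theorem dtut_one_zero_of_doublingAt {X : Type*} [MetricSpace X] [Infinite X]
    (hfin : ∀ (x : X) (R : ℝ), (Metric.closedBall x R).Finite) {K : ℕ}
    (hK : ∀ r₀ : ℕ, ∃ r ≥ r₀, DoublingAt X K r) : DTUT X 1 0 := by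
  refine ⟨fun _ => (K + 1) * (K + 1), fun h k _ => ?_⟩
  set κ : ℕ := (k 0 : ℕ)
  set H : ℕ+ := h (k 1)
  obtain ⟨r, hr₀, hr⟩ := hK (k 1)
  have hr₀' : ((k 1 : ℕ) : ℝ) ≤ r := by exact_mod_cast hr₀
  obtain ⟨Z, hZinf, hZsep, hZcov⟩ := hr.exists_separated_cover hfin
  obtain ⟨N, hN₀, hN⟩ := hK (H * (κ + 4 * r) + κ + 2 * r)
  have hN₀' : (H : ℝ) * (κ + 4 * r) + κ + 2 * r ≤ N := by exact_mod_cast hN₀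
  obtain ⟨Y, -, hYsep, hYnet⟩ := exists_separated_net (X := X) (δ := 2 * N) (by positivity)
    (Set.pairwise_empty _)
  let W : ℝ := κ + 4 * r
  have hW : 0 ≤ W := by positivity
  let ρ : ℕ+ → ℝ := fun t => 2 * N + t * W
  let T : X → Set ℕ+ := fun u => {t : ℕ+ | t ≤ H ∧ ∃ z ∈ Y, ∃ x, dist x u ≤ 2 * r ∧
    ρ t < dist x z ∧ dist x z ≤ ρ t + κ}
  have hT : ∀ u, (T u).Finite ∧ (T u).ncard ≤ K :=
    hN.finite_shells hYsep (by simp only [W]; linarith) H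
      (by simp only [W]; linarith [(Nat.cast_nonneg N : (0 : ℝ) ≤ N)]) hW
  choose τ hτT hτA using fun j => exists_slot_assignment (hZinf j) T hT
  let D : ℕ+ → ℕ → Set (Set X) := fun t s => {U | ∃ u ∈ Z (s / (K + 1)),
    τ (s / (K + 1)) u (s % (K + 1)) = t ∧ U = Metric.closedBall u (2 * r)}
  have hDdisj : ∀ s : ℕ, ∀ t t' : ℕ+, ∀ U ∈ D t s, ∀ V ∈ D t' s, (U ≠ V ∨ t ≠ t') →
      ∀ x ∈ U, ∀ y ∈ V, (r : ℝ) < dist x y := by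
    rintro s t t' _ ⟨u, hu, hut, rfl⟩ _ ⟨v, hv, hvt, rfl⟩ hne x hx y hy
    have huv : u ≠ v := by
      rintro rfl
      exact hne.elim (fun h => h rfl) fun h => h (hut.symm.trans hvt)
    have h1 := hZsep _ hu hv huv
    rw [Metric.mem_closedBall] at hx hy
    linarith [dist_triangle u x v, dist_triangle x y v, dist_comm u x]
  refine ⟨fun l _ => carvedCell Y (ρ (l 0)) κ '' Y, fun l i s => D (l i) s, fun l hl => ⟨⟨?_, ?_, ?_,
    ?_, ?_⟩, fun i s => ⟨?_, ?_, ?_⟩⟩⟩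
  · refine fun _ => ⟨2 * ρ (l 0) + 1, by positivity, ?_⟩
    rintro _ ⟨z, -, rfl⟩ x hx y hy
    linarith [hx.1, hy.1, dist_triangle_right x y z]
  · refine fun i s => ⟨4 * r + 1, by positivity, ?_⟩
    rintro _ ⟨u, -, -, rfl⟩ x hx y hy
    rw [Metric.mem_closedBall] at hx hy
    linarith [dist_triangle_right x y u]
  · rintro - _ ⟨z, hz, rfl⟩ _ ⟨w, hw, rfl⟩ hne x hx y hy
    exact le_dist_of_mem_carvedCell hz hw (fun h => hne (h ▸ rfl)) hx hy
  · intro i s U hU V hV hne x hx y hy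
    obtain rfl : i = 0 := Subsingleton.elim _ _
    exact hr₀'.trans (hDdisj s _ _ U hU V hV (Or.inl hne) x hx y hy).le
  · refine Set.eq_univ_of_forall fun x => ?_
    by_cases hx : ∀ z ∈ Y, ρ (l 0) < dist x z → ρ (l 0) + κ < dist x z
    · obtain ⟨z, hz, hxz⟩ := exists_mem_carvedCell (by
        obtain ⟨z, hz, hxz⟩ := hYnet x
        exact ⟨z, hz, hxz.trans (le_add_of_nonneg_right (by positivity))⟩) hx
      exact Or.inl (Set.mem_iUnion.2 ⟨0, _, ⟨z, hz, rfl⟩, hxz⟩)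
    · push Not at hx
      obtain ⟨z, hz, hlo, hhi⟩ := hx
      obtain ⟨j, hj, u, hu, hxu⟩ := hZcov x
      obtain ⟨b, hb, hτ⟩ := hτT j u (l 0) ⟨hl 0, z, hz, x, hxu, hlo, hhi⟩
      have hs : j * (K + 1) + b < (K + 1) * (K + 1) + 1 := by
        nlinarith [Nat.mul_le_mul_right (K + 1) hj]
      have hdiv : (j * (K + 1) + b) / (K + 1) = j := by
        rw [mul_comm, Nat.mul_add_div (Nat.succ_pos K), Nat.div_eq_of_lt (by omega), add_zero]
      have hmod : (j * (K + 1) + b) % (K + 1) = b := by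
        rw [mul_comm, Nat.mul_add_mod, Nat.mod_eq_of_lt (by omega)]
      refine Or.inr (Set.mem_iUnion.2 ⟨0, Set.mem_iUnion.2 ⟨⟨_, hs⟩, _, ⟨u, ?_, ?_, rfl⟩, hxu⟩⟩)
      · simpa only [hdiv] using hu
      · simpa only [hdiv, hmod] using hτ
  · intro t _
    obtain ⟨u, hu, hut⟩ := hτA (s / (K + 1)) (s % (K + 1)) t
    exact ⟨u, _, ⟨u, hu, by simpa using hut, rfl⟩, Metric.mem_closedBall_self (by positivity)⟩
  · intro t t' _ _ hne
    rw [Set.disjoint_left]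
    rintro x ⟨U, hU, hxU⟩ ⟨V, hV, hxV⟩
    simp only [Function.update_self] at hU hV
    have := hDdisj s t t' U hU V hV (Or.inr hne) x hxU x hxV
    rw [dist_self] at this
    exact absurd this (not_lt.2 (Nat.cast_nonneg r))
  · intro U hU V hV hne x hx y hy
    obtain rfl : i = 0 := Subsingleton.elim _ _
    simp only [Function.update_self, Set.mem_iUnion] at hU hV
    obtain ⟨t, -, hU⟩ := hU
    obtain ⟨t', -, hV⟩ := hV
    exact hr₀'.trans (hDdisj s t t' U hU V hV (Or.inl hne) x hx y hy).le

theorem dtut_zero_zero_of_finite (X : Type*) [MetricSpace X] [Finite X] : DTUT X 0 0 := by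
  refine ⟨Fin.elim0, fun h k _ => ⟨fun _ _ => {Set.univ}, fun _ i => i.elim0, fun l _ =>
    ⟨⟨fun _ => ?_, fun i => i.elim0, fun _ => ?_, fun i => i.elim0, ?_⟩, fun i => i.elim0⟩⟩⟩
  · refine ⟨Metric.diam (Set.univ : Set X) + 1, ?_, fun U _ x _ y _ => ?_⟩
    · linarith [(Metric.diam_nonneg : 0 ≤ Metric.diam (Set.univ : Set X))]
    linarith [Metric.dist_le_diam_of_mem (Set.finite_univ (α := X)).isBounded
      (Set.mem_univ x) (Set.mem_univ y)]
  · rintro U rfl V rfl h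
    exact absurd rfl h
  · refine Set.eq_univ_of_forall fun x => Or.inl (Set.mem_iUnion.2 ⟨0, Set.univ, rfl, trivial⟩)

/-- A polynomially bounded positive function is doubling at arbitrarily large scales. -/
theorem exists_le_mul_of_polynomial_bound {f : ℕ → ℕ} (hpos : ∀ r, 0 < f r) {C d : ℕ}
    (hf : ∀ r, f r ≤ C * (r + 1) ^ d) (r₀ : ℕ) :
    ∃ r ≥ r₀, f (6 * r) ≤ 2 * 6 ^ d * f r := by
  by_contra! hcon
  have hgrow : ∀ i, (2 * 6 ^ d) ^ i ≤ f (6 ^ i * (r₀ + 1)) := by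
    intro i
    induction i with
    | zero => rw [pow_zero]; exact hpos _
    | succ i ih =>
      have h1 : r₀ ≤ 6 ^ i * (r₀ + 1) := by nlinarith [Nat.one_le_pow i 6 (by norm_num)]
      calc (2 * 6 ^ d) ^ (i + 1) = 2 * 6 ^ d * (2 * 6 ^ d) ^ i := by ring
        _ ≤ 2 * 6 ^ d * f (6 ^ i * (r₀ + 1)) := Nat.mul_le_mul_left _ ih
        _ ≤ f (6 * (6 ^ i * (r₀ + 1))) := (hcon _ h1).le
        _ = f (6 ^ (i + 1) * (r₀ + 1)) := by congr 1; ring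
  have hbound : ∀ i, 2 ^ i ≤ C * (r₀ + 2) ^ d := by
    intro i
    have h6 : 1 ≤ 6 ^ i := Nat.one_le_pow i 6 (by norm_num)
    have h1 : 6 ^ i * (r₀ + 1) + 1 ≤ 6 ^ i * (r₀ + 2) := by nlinarith
    have h2 : 2 ^ i * (6 ^ i) ^ d ≤ C * (r₀ + 2) ^ d * (6 ^ i) ^ d :=
      calc 2 ^ i * (6 ^ i) ^ d = (2 * 6 ^ d) ^ i := by rw [mul_pow, ← pow_mul, ← pow_mul, mul_comm i]
        _ ≤ f (6 ^ i * (r₀ + 1)) := hgrow i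
        _ ≤ C * (6 ^ i * (r₀ + 1) + 1) ^ d := hf _
        _ ≤ C * (6 ^ i * (r₀ + 2)) ^ d := by gcongr
        _ = C * (r₀ + 2) ^ d * (6 ^ i) ^ d := by rw [mul_pow]; ring
    exact Nat.le_of_mul_le_mul_right h2 (by positivity)
  exact absurd (hbound _) (not_le.2 (Nat.lt_two_pow_self (n := C * (r₀ + 2) ^ d)))

theorem finite_setOf_wordLength_le {G : Type*} [Group G] (S : Finset G)
    (hgen : Subgroup.closure (S : Set G) = ⊤) (n : ℕ) :
    {g : G | wordLength (S : Set G) g ≤ n}.Finite := by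
  have hA : {x : G | x ∈ (S : Set G) ∨ x⁻¹ ∈ (S : Set G)}.Finite :=
    S.finite_toSet.union (S.finite_toSet.preimage inv_injective.injOn)
  have := hA.to_subtype
  refine ((List.finite_length_le {x : G | x ∈ (S : Set G) ∨ x⁻¹ ∈ (S : Set G)} n).image
    fun L => (L.map Subtype.val).prod).subset fun g hg => ?_
  have hne : {n : ℕ | ∃ L : List G, (∀ x ∈ L, x ∈ (S : Set G) ∨ x⁻¹ ∈ (S : Set G)) ∧ L.prod = g ∧
      L.length = n}.Nonempty := by
    obtain ⟨L, hL, hprod⟩ := Submonoid.exists_list_of_mem_closure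
      (show g ∈ Submonoid.closure ((S : Set G) ∪ (S : Set G)⁻¹) by
        rw [← Subgroup.closure_toSubmonoid, hgen]
        exact Subgroup.mem_top g)
    exact ⟨_, L, hL, hprod, rfl⟩
  obtain ⟨L, hL, hprod, hlen⟩ := Nat.sInf_mem hne
  lift L to List {x : G | x ∈ (S : Set G) ∨ x⁻¹ ∈ (S : Set G)} using hL
  refine ⟨L, ?_, hprod⟩
  rw [List.length_map] at hlen
  exact hlen.trans_le hg

/-- For a left-invariant proper metric, growth control of balls gives doubling. -/
theorem doublingAt_of_card_le {G : Type*} [Group G] [MetricSpace G] (hinv : LeftInvariant G)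
    (hfin : ProperMet G) {K r : ℕ}
    (hcard : (Metric.closedBall (1 : G) (6 * r)).ncard ≤
      K * (Metric.closedBall (1 : G) r).ncard) : DoublingAt G K r := by
  intro Z hZ x
  have hball : ∀ (g : G) (R : ℝ), (Metric.closedBall g R).ncard =
      (Metric.closedBall (1 : G) R).ncard := by
    intro g R
    rw [← Set.ncard_image_of_injective (Metric.closedBall (1 : G) R) (mul_right_injective g)]
    congr 1
    ext y
    simp only [Set.mem_image, Metric.mem_closedBall]
    refine ⟨fun hy => ⟨g⁻¹ * y, ?_, by group⟩, ?_⟩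
    · rw [← hinv g]; simpa using hy
    · rintro ⟨y, hy, rfl⟩
      rw [← hinv g] at hy; simpa using hy
  have hZfin : {z ∈ Z | dist x z ≤ 5 * r}.Finite :=
    (hfin x (5 * r)).subset fun z hz => by simpa [dist_comm] using hz.2
  refine ⟨hZfin, ?_⟩
  have hpos : 0 < (Metric.closedBall (1 : G) r).ncard :=
    (Set.ncard_pos (hfin _ _)).2 ⟨1, Metric.mem_closedBall_self (by positivity)⟩
  have hsum : ({z ∈ Z | dist x z ≤ 5 * r}).ncard * (Metric.closedBall (1 : G) r).ncard ≤
      (Metric.closedBall (1 : G) (6 * r)).ncard := by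
    classical
    rw [Set.ncard_eq_toFinset_card _ hZfin, ← smul_eq_mul, ← Finset.sum_const, ← hball x (6 * r),
      Set.ncard_eq_toFinset_card _ (hfin x (6 * r)),
      Finset.sum_congr rfl fun z _ => (hball z r).symm.trans
      (Set.ncard_eq_toFinset_card _ (hfin z r)), ← Finset.card_biUnion]
    · refine Finset.card_le_card fun y hy => ?_
      simp only [Finset.mem_biUnion, Set.Finite.mem_toFinset, Metric.mem_closedBall] at hy ⊢
      obtain ⟨z, hz, hy⟩ := hy
      linarith [hz.2, dist_triangle y z x, dist_comm x z]
    · intro z hz w hw hne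
      refine Finset.disjoint_left.2 fun y hyz hyw => ?_
      rw [Set.Finite.mem_toFinset, Metric.mem_closedBall] at hyz hyw
      rw [Set.Finite.coe_toFinset] at hz hw
      linarith [hZ hz.1 hw.1 hne, dist_triangle_left z w y]
  exact Nat.le_of_mul_le_mul_right (hsum.trans hcard) hpos

end APC

/-- Every finitely generated group of polynomial growth, with the word
metric of a finite generating set, has the `(m,0)`-DTUT property for some `m`. -/
theorem polynomial_growth_dtut {G : Type*} [Group G] [MetricSpace G]
    (S : Finset G) (hgen : Subgroup.closure (S : Set G) = ⊤)
    (hword : ∀ x y : G, dist x y = (wordLength (S : Set G) (x⁻¹ * y) : ℝ))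
    (hgrowth : ∃ C d : ℕ, ∀ r : ℕ,
      Nat.card {g : G | dist (1 : G) g ≤ (r : ℝ)} ≤ C * (r + 1) ^ d) :
    ∃ m : ℕ, DTUT G m 0 := by
  rcases finite_or_infinite G with _ | _
  · exact ⟨0, dtut_zero_zero_of_finite G⟩
  have hinv : LeftInvariant G := fun g x y => by
    rw [hword, hword, mul_inv_rev, mul_assoc, inv_mul_cancel_left]
  have hproper : ProperMet G := by
    intro x R
    refine ((finite_setOf_wordLength_le S hgen ⌊R⌋₊).image fun g => x * g).subset fun y hy => ?_
    refine ⟨x⁻¹ * y, Nat.le_floor ?_, by group⟩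
    rw [← hword, dist_comm]
    exact hy
  obtain ⟨C, d, hCd⟩ := hgrowth
  have hbound : ∀ r : ℕ, (Metric.closedBall (1 : G) r).ncard ≤ C * (r + 1) ^ d := by
    intro r
    refine le_of_eq_of_le ?_ (hCd r)
    rw [Nat.card_coe_set_eq]
    congr 1
    ext y
    simp [dist_comm]
  refine ⟨1, dtut_one_zero_of_doublingAt (K := 2 * 6 ^ d) hproper fun r₀ => ?_⟩
  obtain ⟨r, hr, hle⟩ := exists_le_mul_of_polynomial_bound
    (f := fun r : ℕ => (Metric.closedBall (1 : G) r).ncard)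
    (fun r => (Set.ncard_pos (hproper _ _)).2 ⟨1, Metric.mem_closedBall_self (by positivity)⟩)
    hbound r₀
  exact ⟨r, hr, doublingAt_of_card_le hinv hproper (by exact_mod_cast hle)⟩
end
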